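/- arXiv:1412.1515 — 13 statements merged into one kernel-verified Lean document; each statement's English description precedes it below -/
import Mathlib

section
/- Let r > 0 and c ≤ d be real numbers, and let a < b be real numbers. Then for every sequence of functions f_n : [a,b] → [c,d] each of variation at most r (i.e., sup over all chains x_0 ≤ x_1 ≤ ⋯ ≤ x_m in [a,b] of Σ_{i<m} |f(x_{i+1}) − f(x_i)| is ≤ r), there exists a subsequence f_{n_k} converging pointwise on [a,b] to some function f : [a,b] → [c,d] of variation at most r. That is, BV_r([a,b],[c,d]) is sequentially compact in the topology of pointwise convergence. -/
open Filter Topology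

/-- `f` has variation at most `r` on the linearly ordered set `X`. -/
def RealVarLE {X : Type*} [LinearOrder X] (f : X → ℝ) (r : ℝ) : Prop :=
  ∀ (n : ℕ) (x : ℕ → X), (∀ i, x i ≤ x (i + 1)) →
    ∑ i ∈ Finset.range n, |f (x (i + 1)) - f (x i)| ≤ r

theorem RealVarLE.eVariationOn_univ_le {X : Type*} [LinearOrder X] {f : X → ℝ} {r : ℝ}
    (h : RealVarLE f r) : eVariationOn f Set.univ ≤ ENNReal.ofReal r := by
  refine iSup_le fun ⟨n, u, hu, _⟩ => ?_
  simp only [edist_dist, Real.dist_eq]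
  rw [← ENNReal.ofReal_sum_of_nonneg fun i _ => abs_nonneg _]
  exact ENNReal.ofReal_le_ofReal (h n u fun i => hu (Nat.le_succ i))

theorem RealVarLE.boundedVariationOn_univ {X : Type*} [LinearOrder X] {f : X → ℝ} {r : ℝ}
    (h : RealVarLE f r) : BoundedVariationOn f Set.univ :=
  ne_top_of_le_ne_top ENNReal.ofReal_ne_top h.eVariationOn_univ_le

theorem RealVarLE.abs_variationOnFromTo_univ_le {X : Type*} [LinearOrder X] {f : X → ℝ} {r : ℝ}
    (hr : 0 ≤ r) (h : RealVarLE f r) (x y : X) :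
    |variationOnFromTo f Set.univ x y| ≤ r :=
  (variationOnFromTo.abs_le_eVariationOn h.boundedVariationOn_univ).trans
    (ENNReal.toReal_le_of_le_ofReal hr h.eVariationOn_univ_le)

theorem RealVarLE.of_tendsto {X ι : Type*} [LinearOrder X] {l : Filter ι} [l.NeBot]
    {f : ι → X → ℝ} {g : X → ℝ} {r : ℝ} (hf : ∀ i, RealVarLE (f i) r)
    (hg : ∀ x, Tendsto (fun i => f i x) l (𝓝 (g x))) : RealVarLE g r := fun n x hx =>
  le_of_tendsto' (tendsto_finsetSum _ fun i _ => ((hg (x (i + 1))).sub (hg (x i))).abs)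
    fun k => hf k n x hx

/-- Bounded functions on a linear order whose increments are dominated by the increments of
uniformly bounded functions have a pointwise convergent subsequence. -/
theorem exists_subseq_tendsto_of_abs_sub_le_sub {X : Type*} [LinearOrder X] [TopologicalSpace X]
    [OrderTopology X] [SecondCountableTopology X] [DenselyOrdered X] {f V : ℕ → X → ℝ}
    {c d c' d' : ℝ} (hf : ∀ n x, f n x ∈ Set.Icc c d) (hV : ∀ n x, V n x ∈ Set.Icc c' d')
    (hfV : ∀ n x y, x ≤ y → |f n y - f n x| ≤ V n y - V n x) :
    ∃ φ : ℕ → ℕ, StrictMono φ ∧ ∃ g : X → ℝ,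
      ∀ x, Tendsto (fun k => f (φ k) x) atTop (𝓝 (g x)) := by
  have hlim {u : ℕ → ℝ} {p q : ℝ} (hu : ∀ n, u n ∈ Set.Icc p q) :
      ∃ l, Tendsto u (hyperfilter ℕ) (𝓝 l) := by
    obtain ⟨l, -, hl⟩ := isCompact_Icc.ultrafilter_le_nhds ((hyperfilter ℕ).map u)
      (le_principal_iff.2 (Eventually.of_forall hu : ∀ᶠ n in (hyperfilter ℕ : Filter ℕ), _))
    exact ⟨l, hl⟩
  choose g hg using fun x => hlim fun n => hf n x
  choose W hW using fun x => hlim fun n => hV n x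
  have hgW : ∀ x y, x ≤ y → |g y - g x| ≤ W y - W x := fun x y hxy =>
    le_of_tendsto_of_tendsto' ((hg y).sub (hg x)).abs ((hW y).sub (hW x)) fun n => hfV n x y hxy
  have hWmono : Monotone W := fun x y hxy =>
    sub_nonneg.1 ((abs_nonneg _).trans (hgW x y hxy))
  obtain ⟨D, hDc, hDd, hbot, htop⟩ := exists_countable_dense_bot_top X
  set C : Set X := D ∪ {x | ¬ ContinuousAt W x} with hC
  have : Countable C := (hDc.union hWmono.countable_not_continuousAt).to_subtype
  let u : ℕ → C → ℝ × ℝ := fun n x => (f n x, V n x)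
  have hu : MapClusterPt (fun x : C => (g x, W x)) atTop u :=
    mapClusterPt_iff_ultrafilter.2 ⟨hyperfilter ℕ, Nat.hyperfilter_le_atTop,
      tendsto_pi_nhds.2 fun x => (hg x).prodMk_nhds (hW x)⟩
  obtain ⟨φ, hφ, hlimφ⟩ := hu.tendsto_subseq
  have hCf : ∀ x ∈ C, Tendsto (fun k => f (φ k) x) atTop (𝓝 (g x)) := fun x hx =>
    (continuous_fst.tendsto _).comp (tendsto_pi_nhds.1 hlimφ ⟨x, hx⟩)
  have hCV : ∀ x ∈ C, Tendsto (fun k => V (φ k) x) atTop (𝓝 (W x)) := fun x hx =>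
    (continuous_snd.tendsto _).comp (tendsto_pi_nhds.1 hlimφ ⟨x, hx⟩)
  refine ⟨φ, hφ, g, fun x => ?_⟩
  by_cases hx : x ∈ C
  · exact hCf x hx
  simp only [hC, Set.mem_union, Set.mem_ofPred_eq, not_or, not_not] at hx
  obtain ⟨hxD, hcont⟩ := hx
  have hxbot : ∃ y, y < x := by simpa [IsBot] using mt (hbot x) hxD
  have hxtop : ∃ y, x < y := by simpa [IsTop] using mt (htop x) hxD
  refine Metric.tendsto_atTop'.2 fun ε hε => ?_
  obtain ⟨l, m, ⟨hlx, hxm⟩, hlm⟩ := (mem_nhds_iff_exists_Ioo_subset' hxbot hxtop).1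
    (hcont (Metric.ball_mem_nhds (W x) (show 0 < ε / 8 by positivity)))
  obtain ⟨p, hpD, hlp, hpx⟩ := hDd.exists_between hlx
  obtain ⟨q, hqD, hxq, hqm⟩ := hDd.exists_between hxm
  have hp : |W p - W x| < ε / 8 := hlm ⟨hlp, hpx.trans hxm⟩
  have hq : |W q - W x| < ε / 8 := hlm ⟨hlx.trans hxq, hqm⟩
  have near {v : ℕ → ℝ} {w : ℝ} (h : Tendsto v atTop (𝓝 w)) : ∀ᶠ k in atTop, |v k - w| < ε / 8 :=
    h (Metric.ball_mem_nhds w (by positivity))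
  obtain ⟨N, hN⟩ := eventually_atTop.1 <| (near (hCf p (.inl hpD))).and <|
    (near (hCV p (.inl hpD))).and (near (hCV q (.inl hqD)))
  refine ⟨N, fun k hk => ?_⟩
  obtain ⟨h₁, h₂, h₃⟩ := hN k hk.le
  have h₄ := hfV (φ k) p x hpx.le
  have h₅ := (abs_nonneg _).trans (hfV (φ k) x q hxq.le)
  have h₆ := hgW p x hpx.le
  rw [Real.dist_eq]
  rw [abs_lt] at *
  rw [abs_le] at h₄ h₆
  constructor <;> linarith

/-- Helly's selection theorem: `BV_r([a,b],[c,d])` is sequentially compact in the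
topology of pointwise convergence. -/
theorem helly_selection_classic {a b c d r : ℝ} (hab : a < b) (hcd : c ≤ d) (hr : 0 < r)
    (f : ℕ → Set.Icc a b → ℝ)
    (hrange : ∀ n x, f n x ∈ Set.Icc c d)
    (hvar : ∀ n, RealVarLE (f n) r) :
    ∃ φ : ℕ → ℕ, StrictMono φ ∧ ∃ g : Set.Icc a b → ℝ,
      (∀ x, g x ∈ Set.Icc c d) ∧ RealVarLE g r ∧
      ∀ x, Tendsto (fun k => f (φ k) x) atTop (𝓝 (g x)) := by
  have : Fact (a ≤ b) := ⟨hab.le⟩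
  obtain ⟨φ, hφ, g, hg⟩ := exists_subseq_tendsto_of_abs_sub_le_sub
    (V := fun n => variationOnFromTo (f n) Set.univ ⊥) hrange
    (fun n x => abs_le.1 ((hvar n).abs_variationOnFromTo_univ_le hr.le ⊥ x))
    fun n x y hxy => variationOnFromTo.abs_sub_le_sub_of_le
      (hvar n).boundedVariationOn_univ.locallyBoundedVariationOn
      (Set.mem_univ _) (Set.mem_univ _) (Set.mem_univ _) hxy
  exact ⟨φ, hφ, g,
    fun x => isClosed_Icc.mem_of_tendsto (hg x) (Eventually.of_forall fun k => hrange (φ k) x),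
    RealVarLE.of_tendsto (fun k => hvar (φ k)) hg, hg⟩
end

section
/- Let X be a compact Hausdorff topological space and F ⊆ C(X) a uniformly bounded set of continuous real-valued functions on X. The following are equivalent: (1) F contains no l1-sequence, i.e., no sequence (f_n) in F for which there is a > 0 with a·Σ_{i=1}^n |c_i| ≤ sup_{x∈X} |Σ_{i=1}^n c_i f_i(x)| for all n and all real scalars c_1,…,c_n; (2) F contains no independent sequence; (3) every sequence in F has a subsequence converging pointwise on X (to some function in ℝ^X); (4) every function in the closure of F in ℝ^X with the product topology is fragmented. -/
open Filter Topology

/-- A sequence of real-valued functions on a set `X` is independent. -/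
def IndependentSeq {X : Type*} (f : ℕ → X → ℝ) : Prop :=
  ∃ a b : ℝ, a < b ∧ ∀ P M : Finset ℕ, Disjoint P M →
    ((⋂ n ∈ P, f n ⁻¹' Set.Iio a) ∩ ⋂ n ∈ M, f n ⁻¹' Set.Ioi b).Nonempty

/-- A real-valued function on a topological space is fragmented (with respect to the
standard metric uniformity on `ℝ`). -/
def FragmentedR {X : Type*} [TopologicalSpace X] (f : X → ℝ) : Prop :=
  ∀ A : Set X, A.Nonempty → ∀ ε : ℝ, 0 < ε → ∃ O : Set X, IsOpen O ∧ (O ∩ A).Nonempty ∧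
    ∀ x ∈ O ∩ A, ∀ y ∈ O ∩ A, |f x - f y| < ε

/-- The open game in which successive moves enumerate a set of naturals increasingly is won from
the position `s` by restricting each move to a hyperfilter-large set: `S` is then reached. -/
def LargeWin (S : Set (Finset ℕ)) (s : Finset ℕ) : Prop :=
  ∃ T : Finset ℕ → Set ℕ, (∀ t, T t ∈ hyperfilter ℕ) ∧ ∀ φ : ℕ → ℕ, StrictMono φ →
    s = (Finset.range s.card).image φ →
    (∀ i, s.card ≤ i → φ i ∈ T ((Finset.range i).image φ)) →
    ∃ k, (Finset.range k).image φ ∈ S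

theorem LargeWin.of_mem {S : Set (Finset ℕ)} {s : Finset ℕ} (hs : s ∈ S) : LargeWin S s :=
  ⟨fun _ => Set.univ, fun _ => univ_mem, fun _ _ h _ => ⟨s.card, h ▸ hs⟩⟩

theorem LargeWin.of_insert {S : Set (Finset ℕ)} {s : Finset ℕ}
    (h : {n | LargeWin S (insert n s)} ∈ hyperfilter ℕ) : LargeWin S s := by
  classical
  have key : ∀ n, ∃ T : Finset ℕ → Set ℕ, (∀ t, T t ∈ hyperfilter ℕ) ∧
      (LargeWin S (insert n s) → ∀ φ : ℕ → ℕ, StrictMono φ →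
        insert n s = (Finset.range (insert n s).card).image φ →
        (∀ i, (insert n s).card ≤ i → φ i ∈ T ((Finset.range i).image φ)) →
        ∃ k, (Finset.range k).image φ ∈ S) := by
    intro n
    by_cases hn : LargeWin S (insert n s)
    · obtain ⟨T, hT, hT'⟩ := hn
      exact ⟨T, hT, fun _ => hT'⟩
    · exact ⟨fun _ => Set.univ, fun _ => univ_mem, fun h => absurd h hn⟩
  choose T hT hT' using key
  refine ⟨fun t => {n | LargeWin S (insert n s)} ∩ ⋂ n ∈ t, T n t,
    fun t => inter_mem h ((biInter_finset_mem t).2 fun n _ => hT n t), ?_⟩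
  intro φ hφ hs hmove
  have hns : φ s.card ∉ s := by
    intro hmem
    obtain ⟨j, hj, hjs⟩ := Finset.mem_image.1 ((Finset.ext_iff.1 hs _).1 hmem)
    exact (Finset.mem_range.1 hj).ne (hφ.injective hjs)
  have hins : insert (φ s.card) s = (Finset.range (s.card + 1)).image φ := by
    rw [Finset.range_add_one, Finset.image_insert, ← hs]
  refine hT' (φ s.card) (hmove _ le_rfl).1 φ hφ ?_ ?_
  · rw [Finset.card_insert_of_notMem hns, hins]
  · intro i hi
    rw [Finset.card_insert_of_notMem hns] at hi
    have := (hmove i (by omega)).2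
    simp only [Set.mem_iInter] at this
    exact this _ (Finset.mem_image_of_mem _ (Finset.mem_range.2 hi))

/-- A sequence each of whose terms meets countably many hyperfilter-large requirements attached to
the finite sets of earlier values. -/
theorem exists_strictMono_mem_of_hyperfilter (T : ℕ → Finset ℕ → Set ℕ)
    (hT : ∀ p t, T p t ∈ hyperfilter ℕ) :
    ∃ h : ℕ → ℕ, StrictMono h ∧
      ∀ m n, m < n → ∀ p ≤ m, ∀ t ⊆ Finset.range (h m + 1), h n ∈ T p t := by
  have hD : ∀ m : ℕ, ∃ n, m < n ∧ ∀ p ≤ m, ∀ t ⊆ Finset.range (m + 1), n ∈ T p t := by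
    intro m
    have h1 : Set.Ioi m ∈ hyperfilter ℕ :=
      mem_hyperfilter_of_finite_compl (by simp)
    have h2 : (⋂ p ∈ Finset.range (m + 1), ⋂ t ∈ (Finset.range (m + 1)).powerset, T p t) ∈
        hyperfilter ℕ :=
      (biInter_finset_mem _).2 fun p _ => (biInter_finset_mem _).2 fun t _ => hT p t
    obtain ⟨n, hn1, hn2⟩ := Ultrafilter.nonempty_of_mem (inter_mem h1 h2)
    refine ⟨n, hn1, fun p hp t ht => ?_⟩
    simp only [Set.mem_iInter] at hn2
    exact hn2 p (by simpa [Nat.lt_succ_iff] using hp) t (Finset.mem_powerset.2 ht)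
  choose D hD1 hD2 using hD
  have hmono : StrictMono fun n => D^[n] 0 := by
    refine strictMono_nat_of_lt_succ fun n => ?_
    rw [Function.iterate_succ_apply']
    exact hD1 _
  refine ⟨fun n => D^[n] 0, hmono, fun m n hmn p hp t ht => ?_⟩
  obtain ⟨k, rfl⟩ : ∃ k, n = k + 1 := ⟨n - 1, by omega⟩
  have hle : D^[m] 0 ≤ D^[k] 0 := hmono.monotone (by omega)
  simp only [Function.iterate_succ_apply']
  refine hD2 _ p (hp.trans ((hmono.id_le m).trans hle)) t (ht.trans ?_)
  exact Finset.range_subset_range.2 (by simpa using hle)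

theorem StrictMono.card_filter_lt_image_range {φ : ℕ → ℕ} (hφ : StrictMono φ) {i k : ℕ}
    (hi : i < k) : (((Finset.range k).image φ).filter (· < φ i)).card = i := by
  have : ((Finset.range k).image φ).filter (· < φ i) = (Finset.range i).image φ := by
    ext m
    simp only [Finset.mem_filter, Finset.mem_image, Finset.mem_range]
    constructor
    · rintro ⟨⟨j, -, rfl⟩, hj⟩
      exact ⟨j, hφ.lt_iff_lt.1 hj, rfl⟩
    · rintro ⟨j, hj, rfl⟩
      exact ⟨⟨j, hj.trans hi, rfl⟩, hφ hj⟩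
  rw [this, Finset.card_image_of_injective _ hφ.injective, Finset.card_range]

/-- The finite index sets along which no point alternates between `f i < a` and `b < f i`. -/
def nonAlternating {X : Type*} (f : ℕ → X → ℝ) (a b : ℝ) : Set (Finset ℕ) :=
  {t | ¬ ∃ x, ∀ i ∈ t, (Even (t.filter (· < i)).card → f i x < a) ∧
    (¬ Even (t.filter (· < i)).card → b < f i x)}

theorem image_range_notMem_nonAlternating {X : Type*} {f : ℕ → X → ℝ} {a b : ℝ} {φ : ℕ → ℕ}
    (hφ : StrictMono φ) {k : ℕ} :
    (Finset.range k).image φ ∉ nonAlternating f a b ↔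
      ∃ x, ∀ i < k, (Even i → f (φ i) x < a) ∧ (¬ Even i → b < f (φ i) x) := by
  simp only [nonAlternating, Set.mem_ofPred_eq, not_not, Finset.forall_mem_image, Finset.mem_range]
  refine exists_congr fun x => forall₂_congr fun i hi => ?_
  rw [hφ.card_filter_lt_image_range hi]

theorem exists_independentSeq_of_not_largeWin {X : Type*} {f : ℕ → X → ℝ} {a b : ℝ} (hab : a < b)
    (h : ¬ LargeWin (nonAlternating f a b) ∅) :
    ∃ φ : ℕ → ℕ, StrictMono φ ∧ IndependentSeq fun n => f (φ n) := by
  set S := nonAlternating f a b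
  obtain ⟨u, hu, huT⟩ := exists_strictMono_mem_of_hyperfilter
    (fun _ t => {n | ¬ LargeWin S t → ¬ LargeWin S (insert n t)}) (by
      intro _ t
      by_cases ht : LargeWin S t
      · exact univ_mem' fun n hn => absurd ht hn
      · have := mt LargeWin.of_insert ht
        rw [← Ultrafilter.compl_mem_iff_notMem] at this
        exact mem_of_superset this fun n hn _ => hn)
  have key : ∀ ψ : ℕ → ℕ, StrictMono ψ → 0 < ψ 0 → ∀ k,
      ¬ LargeWin S ((Finset.range k).image (u ∘ ψ)) := by
    intro ψ hψ h0 k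
    induction k with
    | zero => simpa using h
    | succ k ih =>
      rw [Finset.range_add_one, Finset.image_insert]
      have hpos : 0 < ψ k := h0.trans_le (hψ.monotone (Nat.zero_le k))
      refine huT (ψ k - 1) (ψ k) (by omega) 0 (Nat.zero_le _) _ ?_ ih
      intro m hm
      obtain ⟨j, hj, rfl⟩ := Finset.mem_image.1 hm
      have hjk : ψ j < ψ k := hψ (Finset.mem_range.1 hj)
      have : u (ψ j) ≤ u (ψ k - 1) := hu.monotone (by omega)
      simpa [Nat.lt_succ_iff] using this
  refine ⟨fun n => u (3 * n + 2), fun m n hmn => hu (by omega), a, b, hab, fun P M hPM => ?_⟩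
  classical
  -- the pair of positions `2 * n`, `2 * n + 1` contains `3 * n + 2` at the parity prescribed for `n`
  let ψ : ℕ → ℕ := fun i => 3 * (i / 2) + i % 2 + if i / 2 ∈ P then 2 else 1
  have hψ : StrictMono ψ := by
    refine strictMono_nat_of_lt_succ fun i => ?_
    obtain hi | hi : (i + 1) / 2 = i / 2 ∨ (i + 1) / 2 = i / 2 + 1 := by omega
    · simp only [ψ, hi]
      omega
    · simp only [ψ, hi]
      split_ifs <;> omega
  have h0 : 0 < ψ 0 := by
    simp only [ψ]
    split_ifs <;> omega
  obtain ⟨N, hN⟩ : ∃ N, ∀ n ∈ P ∪ M, n < N :=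
    ⟨(P ∪ M).sup id + 1, fun n hn => Nat.lt_succ_of_le (Finset.le_sup (f := id) hn)⟩
  obtain ⟨x, hx⟩ := (image_range_notMem_nonAlternating (hu.comp hψ)).1
    fun hS => key ψ hψ h0 (2 * N) (LargeWin.of_mem hS)
  refine ⟨x, ?_, ?_⟩
  · simp only [Set.mem_iInter]
    intro n hn
    have h1 := (hx (2 * n) (by have := hN n (Finset.mem_union_left _ hn); omega)).1 (by simp)
    have h2 : ψ (2 * n) = 3 * n + 2 := by simp [ψ, hn]
    simpa [h2] using h1
  · simp only [Set.mem_iInter]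
    intro n hn
    have hnP : n ∉ P := fun h => Finset.disjoint_left.1 hPM h hn
    have h1 := (hx (2 * n + 1) (by have := hN n (Finset.mem_union_right _ hn); omega)).2 (by simp)
    have h2 : ψ (2 * n + 1) = 3 * n + 2 := by
      have : (2 * n + 1) / 2 = n := by omega
      simp only [ψ, this, if_neg hnP]
      omega
    simpa [h2] using h1

/-- **Rosenthal's dichotomy** for pointwise bounded sequences of real functions on a set. -/
theorem exists_independentSeq_or_tendsto {X : Type*} {f : ℕ → X → ℝ} {C : ℝ}
    (hC : ∀ n x, |f n x| ≤ C) :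
    (∃ φ : ℕ → ℕ, StrictMono φ ∧ IndependentSeq fun n => f (φ n)) ∨
      ∃ φ : ℕ → ℕ, StrictMono φ ∧ ∃ g : X → ℝ, ∀ x,
        Tendsto (fun k => f (φ k) x) atTop (𝓝 (g x)) := by
  by_cases hwin : ∀ a b : ℚ, a < b → LargeWin (nonAlternating f a b) ∅
  swap
  · push Not at hwin
    obtain ⟨a, b, hab, h⟩ := hwin
    exact Or.inl (exists_independentSeq_of_not_largeWin (by exact_mod_cast hab) h)
  right
  have hT : ∀ q : ℚ × ℚ, ∃ T : Finset ℕ → Set ℕ, (∀ t, T t ∈ hyperfilter ℕ) ∧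
      (q.1 < q.2 → ∀ φ : ℕ → ℕ, StrictMono φ → (∀ i, φ i ∈ T ((Finset.range i).image φ)) →
        ∃ k, (Finset.range k).image φ ∈ nonAlternating f q.1 q.2) := by
    intro q
    by_cases hq : q.1 < q.2
    · obtain ⟨T, hT, hT'⟩ := hwin _ _ hq
      exact ⟨T, hT, fun _ φ hφ h => hT' φ hφ (by simp) fun i _ => h i⟩
    · exact ⟨fun _ => Set.univ, fun _ => univ_mem, fun h => absurd h hq⟩
  choose T hT hT' using hT
  obtain ⟨e, he⟩ := exists_surjective_nat (ℚ × ℚ)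
  obtain ⟨u, hu, huT⟩ := exists_strictMono_mem_of_hyperfilter (fun p => T (e p)) fun p => hT (e p)
  have hlim : ∀ x, ∃ c, Tendsto (fun k => f (u k) x) atTop (𝓝 c) := by
    intro x
    refine tendsto_of_no_upcrossings Rat.denseRange_cast ?_
      (isBoundedUnder_of ⟨C, fun n => (abs_le.1 (hC _ _)).2⟩)
      (isBoundedUnder_of ⟨-C, fun n => (abs_le.1 (hC _ _)).1⟩)
    rintro _ ⟨a, rfl⟩ _ ⟨b, rfl⟩ hab ⟨h1, h2⟩
    obtain ⟨p, hp⟩ := he (a, b)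
    obtain ⟨ψ, hψ, hψP⟩ := extraction_forall_of_frequently
      (P := fun i k => p < k ∧ (Even i → f (u k) x < a) ∧ (¬ Even i → b < f (u k) x)) (by
        intro i
        refine (Frequently.and_eventually (q := fun k => p < k) ?_
          (eventually_gt_atTop p)).mono fun k hk => ⟨hk.2, hk.1⟩
        by_cases hi : Even i
        · simpa [hi] using h1
        · simpa [hi] using h2)
    obtain ⟨k, hk⟩ := hT' (a, b) (by exact_mod_cast hab) (u ∘ ψ) (hu.comp hψ) (by
      intro i
      have hpi := (hψP i).1
      have := huT (ψ i - 1) (ψ i) (by omega) p (by omega) ((Finset.range i).image (u ∘ ψ)) (by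
        intro m hm
        obtain ⟨j, hj, rfl⟩ := Finset.mem_image.1 hm
        have hji : ψ j < ψ i := hψ (Finset.mem_range.1 hj)
        have : u (ψ j) ≤ u (ψ i - 1) := hu.monotone (by omega)
        simpa [Nat.lt_succ_iff] using this)
      simpa [hp] using this)
    exact (image_range_notMem_nonAlternating (hu.comp hψ)).2
      ⟨x, fun i _ => (hψP i).2⟩ hk
  choose g hg using hlim
  exact ⟨u, hu, g, hg⟩

/-- An independent sequence of continuous functions on a compact space satisfies a lower
`ℓ₁`-estimate. -/
theorem IndependentSeq.exists_mul_sum_abs_le_norm {X : Type*} [TopologicalSpace X] [CompactSpace X]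
    {f : ℕ → C(X, ℝ)} (hf : IndependentSeq fun n => (f n : X → ℝ)) :
    ∃ a : ℝ, 0 < a ∧ ∀ (n : ℕ) (c : ℕ → ℝ),
      a * ∑ i ∈ Finset.range n, |c i| ≤ ‖∑ i ∈ Finset.range n, c i • f i‖ := by
  obtain ⟨a, b, hab, h⟩ := hf
  refine ⟨(b - a) / 2, by linarith, fun n c => ?_⟩
  have hdisj : Disjoint ((Finset.range n).filter (c · < 0)) ((Finset.range n).filter (0 ≤ c ·)) := by
    rw [Finset.disjoint_filter]
    intro i _ h1 h2
    linarith
  obtain ⟨x, hx1, hx2⟩ := h _ _ hdisj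
  obtain ⟨y, hy1, hy2⟩ := h _ _ hdisj.symm
  simp only [Set.mem_iInter, Finset.mem_filter, Finset.mem_range, Set.mem_preimage, Set.mem_Iio,
    Set.mem_Ioi] at hx1 hx2 hy1 hy2
  set G := ∑ i ∈ Finset.range n, c i • f i
  have hG : G x - G y = ∑ i ∈ Finset.range n, c i * (f i x - f i y) := by
    simp [G, ContinuousMap.sum_apply, mul_sub]
  have hle : (b - a) * ∑ i ∈ Finset.range n, |c i| ≤ G x - G y := by
    rw [hG, Finset.mul_sum]
    refine Finset.sum_le_sum fun i hi => ?_
    rw [Finset.mem_range] at hi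
    rcases lt_or_ge (c i) 0 with hc | hc
    · rw [abs_of_neg hc]
      nlinarith [hx1 i ⟨hi, hc⟩, hy2 i ⟨hi, hc⟩]
    · rw [abs_of_nonneg hc]
      nlinarith [hx2 i ⟨hi, hc⟩, hy1 i ⟨hi, hc⟩]
  have h1 := (abs_le.1 (G.norm_coe_le_norm x)).2
  have h2 := (abs_le.1 (G.norm_coe_le_norm y)).1
  linarith

/-- A bounded function that is not fragmented crosses some pair of levels on every nonempty
relatively open part of some set. -/
theorem exists_lt_dense_of_not_fragmentedR {X : Type*} [TopologicalSpace X] {g : X → ℝ} {C : ℝ}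
    (hC : ∀ x, |g x| ≤ C) (hg : ¬ FragmentedR g) :
    ∃ a b : ℝ, a < b ∧ ∃ B : Set X, B.Nonempty ∧ ∀ O, IsOpen O → (O ∩ B).Nonempty →
      (∃ x ∈ O ∩ B, g x < a) ∧ ∃ x ∈ O ∩ B, b < g x := by
  by_contra! hcon
  refine hg fun A hA ε hε => ?_
  have shrink : ∀ n : ℕ, ∃ O, IsOpen O ∧ (O ∩ A).Nonempty ∧
      ∃ c, ∀ x ∈ O ∩ A, c ≤ g x ∧ g x ≤ c + 2 * (C + 1) * (2 / 3) ^ n := by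
    intro n
    induction n with
    | zero =>
      refine ⟨Set.univ, isOpen_univ, by simpa using hA, -C, fun x _ => ?_⟩
      have := abs_le.1 (hC x)
      constructor <;> linarith
    | succ n ih =>
      obtain ⟨O, hO, hOA, c, hc⟩ := ih
      have hCpos : 0 ≤ C := (abs_nonneg _).trans (hC hA.some)
      set d := 2 * (C + 1) * (2 / 3 : ℝ) ^ n with hd
      have hdpos : 0 < d := by positivity
      have hd' : 2 * (C + 1) * (2 / 3 : ℝ) ^ (n + 1) = d * (2 / 3) := by rw [hd]; ring
      obtain ⟨V, hV, hVA, hV'⟩ := hcon (c + d / 3) (c + 2 * d / 3) (by linarith) (O ∩ A) hOA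
      rw [hd']
      refine ⟨V ∩ O, hV.inter hO, by rwa [Set.inter_assoc], ?_⟩
      by_cases hlow : ∃ x ∈ V ∩ (O ∩ A), g x < c + d / 3
      · refine ⟨c, fun x hx => ?_⟩
        rw [Set.inter_assoc] at hx
        have := hV' hlow x hx
        exact ⟨(hc x hx.2).1, by linarith⟩
      · push Not at hlow
        refine ⟨c + d / 3, fun x hx => ?_⟩
        rw [Set.inter_assoc] at hx
        exact ⟨hlow x hx, by linarith [(hc x hx.2).2]⟩
  have hlim : Tendsto (fun n : ℕ => 2 * (C + 1) * (2 / 3 : ℝ) ^ n) atTop (𝓝 0) := by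
    simpa using (tendsto_pow_atTop_nhds_zero_of_lt_one (by norm_num) (by norm_num)).const_mul
      (2 * (C + 1))
  obtain ⟨n, hn⟩ := (hlim.eventually_lt_const hε).exists
  obtain ⟨O, hO, hOA, c, hc⟩ := shrink n
  refine ⟨O, hO, hOA, fun x hx y hy => abs_lt.2 ?_⟩
  have := hc x hx
  have := hc y hy
  constructor <;> linarith

theorem exists_independentSeq_of_not_fragmentedR {X : Type*} [TopologicalSpace X]
    {F : Set C(X, ℝ)} {g : X → ℝ} {C : ℝ} (hC : ∀ x, |g x| ≤ C)
    (hgF : g ∈ closure ((fun f : C(X, ℝ) => (f : X → ℝ)) '' F)) (hg : ¬ FragmentedR g) :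
    ∃ f : ℕ → C(X, ℝ), (∀ n, f n ∈ F) ∧ IndependentSeq fun n => (f n : X → ℝ) := by
  obtain ⟨a, b, hab, B, hB, hdense⟩ := exists_lt_dense_of_not_fragmentedR hC hg
  let State := {W : Set (Set X) // W.Finite ∧ ∀ O ∈ W, IsOpen O ∧ (O ∩ B).Nonempty}
  have step : ∀ s : State, ∃ f ∈ F, ∀ O ∈ s.1,
      ((O ∩ f ⁻¹' Set.Iio a) ∩ B).Nonempty ∧ ((O ∩ f ⁻¹' Set.Ioi b) ∩ B).Nonempty := by
    rintro ⟨W, hW, hWB⟩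
    have hpts : ∀ O : Set X, ∃ x y, O ∈ W → (x ∈ O ∩ B ∧ g x < a) ∧ (y ∈ O ∩ B ∧ b < g y) := by
      intro O
      by_cases hO : O ∈ W
      · obtain ⟨⟨x, hx⟩, y, hy⟩ := hdense O (hWB O hO).1 (hWB O hO).2
        exact ⟨x, y, fun _ => ⟨hx, hy⟩⟩
      · exact ⟨hB.some, hB.some, fun h => absurd h hO⟩
    choose x y hxy using hpts
    have hU : {p : X → ℝ | ∀ O ∈ W, p (x O) < a ∧ b < p (y O)} ∈ 𝓝 g := by
      refine (Filter.eventually_all_finite hW).2 fun O hO => ?_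
      have h1 := ((continuous_apply (x O)).tendsto g).eventually_lt_const (hxy O hO).1.2
      have h2 := ((continuous_apply (y O)).tendsto g).eventually_const_lt (hxy O hO).2.2
      exact h1.and h2
    obtain ⟨_, hp, f, hfF, rfl⟩ := mem_closure_iff_nhds.1 hgF _ hU
    refine ⟨f, hfF, fun O hO => ⟨⟨x O, ?_⟩, ⟨y O, ?_⟩⟩⟩
    · exact ⟨⟨(hxy O hO).1.1.1, (hp O hO).1⟩, (hxy O hO).1.1.2⟩
    · exact ⟨⟨(hxy O hO).2.1.1, (hp O hO).2⟩, (hxy O hO).2.1.2⟩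
  choose next hnextF hnext using step
  let refineState : State → State := fun s =>
    ⟨(fun O => O ∩ next s ⁻¹' Set.Iio a) '' s.1 ∪ (fun O => O ∩ next s ⁻¹' Set.Ioi b) '' s.1,
      (s.2.1.image _).union (s.2.1.image _), by
        rintro _ (⟨O, hO, rfl⟩ | ⟨O, hO, rfl⟩)
        · exact ⟨(s.2.2 O hO).1.inter (isOpen_Iio.preimage (next s).continuous),
            (hnext s O hO).1⟩
        · exact ⟨(s.2.2 O hO).1.inter (isOpen_Ioi.preimage (next s).continuous),
            (hnext s O hO).2⟩⟩
  let start : State := ⟨{Set.univ}, Set.finite_singleton _, by simpa using hB⟩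
  let S : ℕ → State := fun n => refineState^[n] start
  have hS : ∀ n, S (n + 1) = refineState (S n) := fun n => Function.iterate_succ_apply' _ _ _
  refine ⟨fun n => next (S n), fun n => hnextF _, a, b, hab, fun P M hPM => ?_⟩
  have hcell : ∀ n, ∃ O ∈ (S n).1, ∀ z ∈ O, ∀ i < n,
      (i ∈ P → next (S i) z < a) ∧ (i ∉ P → b < next (S i) z) := by
    intro n
    induction n with
    | zero => exact ⟨Set.univ, rfl, fun z _ i hi => absurd hi (Nat.not_lt_zero i)⟩
    | succ n ih =>
      obtain ⟨O, hO, hOz⟩ := ih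
      rw [hS]
      by_cases hn : n ∈ P
      · refine ⟨_, Or.inl ⟨O, hO, rfl⟩, fun z hz i hi => ?_⟩
        rcases Nat.lt_succ_iff_lt_or_eq.1 hi with h | rfl
        · exact hOz z hz.1 i h
        · exact ⟨fun _ => hz.2, fun h => absurd hn h⟩
      · refine ⟨_, Or.inr ⟨O, hO, rfl⟩, fun z hz i hi => ?_⟩
        rcases Nat.lt_succ_iff_lt_or_eq.1 hi with h | rfl
        · exact hOz z hz.1 i h
        · exact ⟨fun h => absurd h hn, fun _ => hz.2⟩
  obtain ⟨O, hO, hOz⟩ := hcell ((P ∪ M).sup id + 1)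
  obtain ⟨z, hz, -⟩ := ((S _).2.2 O hO).2
  have hlt : ∀ n ∈ P ∪ M, n < (P ∪ M).sup id + 1 :=
    fun n hn => Nat.lt_succ_of_le (Finset.le_sup (f := id) hn)
  refine ⟨z, Set.mem_iInter₂.2 fun n hn => ?_, Set.mem_iInter₂.2 fun n hn => ?_⟩
  · exact (hOz z hz n (hlt n (Finset.mem_union_left _ hn))).1 hn
  · exact (hOz z hz n (hlt n (Finset.mem_union_right _ hn))).2 (Finset.disjoint_right.1 hPM hn)

/-- The points whose first `n` values lie below `a` on `σ` and above `b` off `σ`. -/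
def levelCell {X : Type*} (f : ℕ → X → ℝ) (a b : ℝ) (σ : Set ℕ) (n : ℕ) : Set X :=
  {x | ∀ i < n, (i ∈ σ → f i x ≤ a) ∧ (i ∉ σ → b ≤ f i x)}

theorem levelCell_anti {X : Type*} (f : ℕ → X → ℝ) (a b : ℝ) (σ : Set ℕ) :
    Antitone (levelCell f a b σ) :=
  fun _ _ hmn _ hx i hi => hx i (hi.trans_le hmn)

theorem isClosed_levelCell {X : Type*} [TopologicalSpace X] {f : ℕ → X → ℝ}
    (hf : ∀ n, Continuous (f n)) (a b : ℝ) (σ : Set ℕ) (n : ℕ) :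
    IsClosed (levelCell f a b σ n) := by
  simp only [levelCell, Set.ofPred_forall, Set.ofPred_and]
  refine isClosed_iInter fun i => isClosed_iInter fun _ => IsClosed.inter ?_ ?_
  · exact isClosed_iInter fun _ => isClosed_le (hf i) continuous_const
  · exact isClosed_iInter fun _ => isClosed_le continuous_const (hf i)

/-- A closed subset of a compact space meeting all finite cells meets the infinite one. -/
theorem IsClosed.inter_iInter_levelCell_nonempty {X : Type*} [TopologicalSpace X] [CompactSpace X]
    {f : ℕ → X → ℝ} (hf : ∀ n, Continuous (f n)) {a b : ℝ} {σ : Set ℕ} {K : Set X}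
    (hK : IsClosed K) (h : ∀ n, (K ∩ levelCell f a b σ n).Nonempty) :
    (K ∩ ⋂ n, levelCell f a b σ n).Nonempty := by
  have hcl : ∀ n, IsClosed (K ∩ levelCell f a b σ n) := fun n =>
    hK.inter (isClosed_levelCell hf a b σ n)
  rw [Set.inter_iInter]
  exact IsCompact.nonempty_iInter_of_sequence_nonempty_isCompact_isClosed _
    (fun n => Set.inter_subset_inter_right K (levelCell_anti f a b σ n.le_succ)) h
    (hcl 0).isCompact hcl

/-- There is a minimal closed set realizing all patterns of an independent sequence. -/
theorem IndependentSeq.exists_minimal_levelCell {X : Type*} [TopologicalSpace X] [CompactSpace X]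
    {f : ℕ → X → ℝ} (hf : ∀ n, Continuous (f n)) {a b : ℝ}
    (h : ∀ P M : Finset ℕ, Disjoint P M →
      ((⋂ n ∈ P, f n ⁻¹' Set.Iio a) ∩ ⋂ n ∈ M, f n ⁻¹' Set.Ioi b).Nonempty) :
    ∃ K : Set X, Minimal (fun K => IsClosed K ∧
      ∀ σ : Set ℕ, (K ∩ ⋂ n, levelCell f a b σ n).Nonempty) K := by
  classical
  have huniv : IsClosed (Set.univ : Set X) ∧
      ∀ σ : Set ℕ, (Set.univ ∩ ⋂ n, levelCell f a b σ n).Nonempty := by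
    refine ⟨isClosed_univ, fun σ => isClosed_univ.inter_iInter_levelCell_nonempty hf fun n => ?_⟩
    obtain ⟨x, hx1, hx2⟩ := h _ _
      (Finset.disjoint_filter_filter_not (Finset.range n) (Finset.range n) (· ∈ σ))
    simp only [Set.mem_iInter, Finset.mem_filter, Finset.mem_range] at hx1 hx2
    exact ⟨x, trivial, fun i hi => ⟨fun hσ => (hx1 i ⟨hi, hσ⟩).le, fun hσ => (hx2 i ⟨hi, hσ⟩).le⟩⟩
  obtain ⟨K, -, hK⟩ := zorn_superset_nonempty {K | IsClosed K ∧
    ∀ σ : Set ℕ, (K ∩ ⋂ n, levelCell f a b σ n).Nonempty} (by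
      intro c hc hchain hne
      refine ⟨⋂₀ c, ⟨isClosed_sInter fun K hK => (hc hK).1, fun σ => ?_⟩,
        fun K hK => Set.sInter_subset_of_mem hK⟩
      have := hne.to_subtype
      rw [Set.sInter_eq_iInter, Set.iInter_inter]
      have hcl : ∀ K : c, IsClosed (K.1 ∩ ⋂ n, levelCell f a b σ n) := fun K =>
        (hc K.2).1.inter (isClosed_iInter fun n => isClosed_levelCell hf a b σ n)
      refine IsCompact.nonempty_iInter_of_directed_nonempty_isCompact_isClosed _ ?_
        (fun K => (hc K.2).2 σ) (fun K => (hcl K).isCompact) hcl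
      have hchain' : IsChain (· ⊇ ·) c := hchain.symm
      have hdir := DirectedOn.directed_val hchain'.directedOn
      exact hdir.mono_comp (g := (· ∩ ⋂ n, levelCell f a b σ n)) _
        fun _ _ => Set.inter_subset_inter_left _) Set.univ huniv
  exact ⟨K, hK⟩

theorem IndependentSeq.exists_not_fragmentedR {X : Type*} [TopologicalSpace X] [CompactSpace X]
    {f : ℕ → X → ℝ} (hf : ∀ n, Continuous (f n)) {C : ℝ} (hC : ∀ n x, |f n x| ≤ C)
    (h : IndependentSeq f) : ∃ g ∈ closure (Set.range f), ¬ FragmentedR g := by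
  obtain ⟨a, b, hab, h⟩ := h
  obtain ⟨K, ⟨hKcl, hK⟩, hKmin⟩ := IndependentSeq.exists_minimal_levelCell hf h
  have hlim : ∀ x, ∃ c, Tendsto (fun n => f n x) (hyperfilter ℕ) (𝓝 c) := by
    intro x
    obtain ⟨c, -, hc⟩ := (isCompact_Icc (a := -C) (b := C)).ultrafilter_le_nhds
      ((hyperfilter ℕ).map fun n => f n x) (by
        rw [le_principal_iff, Ultrafilter.coe_map, mem_map]
        exact univ_mem' fun n => abs_le.1 (hC n x))
    exact ⟨c, hc⟩
  choose g hg using hlim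
  refine ⟨g, mem_closure_of_tendsto (tendsto_pi_nhds.2 hg)
    (Eventually.of_forall fun n => Set.mem_range_self n), fun hfrag => ?_⟩
  obtain ⟨O, hO, ⟨z, hzO, hzK⟩, hosc⟩ := hfrag K ((hK ∅).mono Set.inter_subset_left) (b - a)
    (by linarith)
  have hdiff : IsClosed (K \ O) := hKcl.sdiff hO
  obtain ⟨σ, n, hn⟩ : ∃ (σ : Set ℕ) (n : ℕ), ¬ (K \ O ∩ levelCell f a b σ n).Nonempty := by
    by_contra! hcon
    have := hKmin ⟨hdiff, fun σ => hdiff.inter_iInter_levelCell_nonempty hf (hcon σ)⟩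
      Set.sdiff_subset hzK
    exact this.2 hzO
  have hmem : ∀ τ : Set ℕ, (∀ i < n, i ∈ τ ↔ i ∈ σ) → ∀ x ∈ K, x ∈ ⋂ n, levelCell f a b τ n →
      x ∈ O ∩ K := by
    intro τ hτ x hxK hx
    refine ⟨by_contra fun hxO => hn ⟨x, ⟨hxK, hxO⟩, fun i hi => ?_⟩, hxK⟩
    rw [← hτ i hi]
    exact Set.mem_iInter.1 hx n i hi
  have hlarge : ∀ᶠ i in (hyperfilter ℕ : Filter ℕ), n ≤ i :=
    Nat.hyperfilter_le_atTop (eventually_ge_atTop n)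
  obtain ⟨x, hxK, hx⟩ := hK (σ ∪ Set.Ici n)
  obtain ⟨y, hyK, hy⟩ := hK (σ ∩ Set.Iio n)
  have hgx : g x ≤ a := le_of_tendsto (hg x) <| hlarge.mono fun i hi =>
    (Set.mem_iInter.1 hx (i + 1) i i.lt_succ_self).1 (Or.inr hi)
  have hgy : b ≤ g y := ge_of_tendsto (hg y) <| hlarge.mono fun i hi =>
    (Set.mem_iInter.1 hy (i + 1) i i.lt_succ_self).2 fun hi' => (Set.mem_Iio.1 hi'.2).not_ge hi
  have := hosc x (hmem _ (fun i hi => by simp [hi]) x hxK hx) y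
    (hmem _ (fun i hi => by simp [hi]) y hyK hy)
  linarith [(abs_lt.1 this).1]

/-- If a uniformly bounded sequence of continuous functions on a compact Hausdorff space tends to
zero pointwise, then every convex set containing all `h k` contains a function lying below any
prescribed `δ > 0`. -/
theorem exists_forall_lt_of_convex_of_tendsto_zero {X : Type*} [TopologicalSpace X]
    [CompactSpace X] [T2Space X] {h : ℕ → C(X, ℝ)} {C : ℝ} (hC : ∀ k x, |h k x| ≤ C)
    (hlim : ∀ x, Tendsto (fun k => h k x) atTop (𝓝 0)) {T : Set C(X, ℝ)} (hT : Convex ℝ T)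
    (hmem : ∀ k, h k ∈ T) {δ : ℝ} (hδ : 0 < δ) : ∃ c ∈ T, ∀ x, c x < δ := by
  by_contra! hcon
  have hS : Convex ℝ {u : C(X, ℝ) | ∀ x, u x < δ} := by
    intro u hu v hv α β hα hβ hαβ x
    exact (convex_Iio δ) (hu x) (hv x) hα hβ hαβ
  have hSo : IsOpen {u : C(X, ℝ) | ∀ x, u x < δ} := by
    simpa [Set.MapsTo] using ContinuousMap.isOpen_setOfPred_mapsTo (X := X) (Y := ℝ)
      isCompact_univ (isOpen_Iio (a := δ))
  obtain ⟨ℓ, s, hℓS, hℓT⟩ := geometric_hahn_banach_open hS hSo hT <| by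
    rw [Set.disjoint_left]
    intro u hu huT
    obtain ⟨x, hx⟩ := hcon u huT
    exact (hu x).not_ge hx
  have hs : 0 < s := by simpa using hℓS 0 fun x => by simpa using hδ
  have hpos : ∀ u : C(X, ℝ), 0 ≤ u → 0 ≤ ℓ u := by
    intro u hu
    by_contra! hneg
    have h1 := hℓS ((s / ℓ u) • u) fun x => by
      have : s / ℓ u ≤ 0 := div_nonpos_of_nonneg_of_nonpos hs.le hneg.le
      have h2 : s / ℓ u * u x ≤ 0 := mul_nonpos_of_nonpos_of_nonneg this (hu x)
      simpa using h2.trans_lt hδ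
    rw [map_smul, smul_eq_mul, div_mul_cancel₀ _ hneg.ne] at h1
    exact lt_irrefl _ h1
  borelize X
  let Λ : CompactlySupportedContinuousMap X ℝ →ₚ[ℝ] ℝ := PositiveLinearMap.mk₀
    { toFun := fun u => ℓ (u : C(X, ℝ))
      map_add' := fun u v => ℓ.map_add (u : C(X, ℝ)) (v : C(X, ℝ))
      map_smul' := fun r u => ℓ.map_smul r (u : C(X, ℝ)) } fun u hu => hpos _ hu
  have hint : ∀ u : C(X, ℝ), ∫ x, u x ∂(RealRMK.rieszMeasure Λ) = ℓ u := fun u =>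
    RealRMK.integral_rieszMeasure Λ (CompactlySupportedContinuousMap.continuousMapEquiv u)
  have htend := MeasureTheory.tendsto_integral_of_dominated_convergence
    (μ := RealRMK.rieszMeasure Λ) (F := fun k x => h k x) (f := fun _ => 0) (fun _ => C)
    (fun k => (h k).continuous.aestronglyMeasurable) (MeasureTheory.integrable_const C)
    (fun k => Eventually.of_forall (hC k)) (Eventually.of_forall hlim)
  simp only [hint, MeasureTheory.integral_zero] at htend
  exact hs.not_ge (ge_of_tendsto' htend fun k => hℓT _ (hmem k))

theorem sum_abs_le_norm_comp_of_injective {E : Type*} [NormedAddCommGroup E] [NormedSpace ℝ E]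
    {f : ℕ → E} {a : ℝ} (hf : ∀ (n : ℕ) (c : ℕ → ℝ),
      a * ∑ i ∈ Finset.range n, |c i| ≤ ‖∑ i ∈ Finset.range n, c i • f i‖)
    {φ : ℕ → ℕ} (hφ : Function.Injective φ) (s : Finset ℕ) (c : ℕ → ℝ) :
    a * ∑ i ∈ s, |c i| ≤ ‖∑ i ∈ s, c i • f (φ i)‖ := by
  classical
  let d : ℕ → ℝ := fun j => if j ∈ s.image φ then Function.extend φ c 0 j else 0
  have hsub : s.image φ ⊆ Finset.range ((s.image φ).sup id + 1) := fun j hj =>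
    Finset.mem_range.2 (Nat.lt_succ_of_le (Finset.le_sup (f := id) hj))
  have hd : ∀ i ∈ s, d (φ i) = c i := fun i hi => by
    simp only [d, if_pos (Finset.mem_image_of_mem φ hi), hφ.extend_apply]
  have key := hf ((s.image φ).sup id + 1) d
  rw [← Finset.sum_subset hsub (fun j _ hj => by simp only [d, if_neg hj, abs_zero]),
    ← Finset.sum_subset hsub (fun j _ hj => by simp only [d, if_neg hj, zero_smul]),
    Finset.sum_image hφ.injOn, Finset.sum_image hφ.injOn] at key
  rwa [Finset.sum_congr rfl fun i hi => by rw [hd i hi],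
    Finset.sum_congr (g := fun i => c i • f (φ i)) rfl fun i hi => by rw [hd i hi]] at key

theorem sum_range_two_mul {M : Type*} [AddCommMonoid M] (u : ℕ → M) (n : ℕ) :
    ∑ i ∈ Finset.range (2 * n), u i = ∑ k ∈ Finset.range n, (u (2 * k) + u (2 * k + 1)) := by
  induction n with
  | zero => simp
  | succ n ih => rw [Nat.mul_succ, Finset.sum_range_succ, Finset.sum_range_succ, ih,
      Finset.sum_range_succ, add_assoc]

/-- A pointwise convergent, uniformly bounded sequence of continuous functions on a compact
Hausdorff space satisfies no lower `ℓ₁`-estimate. -/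
theorem not_sum_abs_le_norm_of_tendsto {X : Type*} [TopologicalSpace X]
    [CompactSpace X] [T2Space X] {f : ℕ → C(X, ℝ)} {C : ℝ} (hC : ∀ n x, |f n x| ≤ C)
    {g : X → ℝ} (hg : ∀ x, Tendsto (fun n => f n x) atTop (𝓝 (g x))) {a : ℝ} (ha : 0 < a) :
    ¬ ∀ (s : Finset ℕ) (c : ℕ → ℝ), a * ∑ i ∈ s, |c i| ≤ ‖∑ i ∈ s, c i • f i‖ := by
  intro hf
  let h : ℕ → C(X, ℝ) := fun k => f (2 * k + 1) - f (2 * k)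
  have hlim : ∀ x, Tendsto (fun k => h k x) atTop (𝓝 0) := by
    intro x
    have h1 : Tendsto (fun k : ℕ => 2 * k) atTop atTop :=
      tendsto_atTop_mono (fun k => by dsimp only [id]; omega) tendsto_id
    have h2 : Tendsto (fun k : ℕ => 2 * k + 1) atTop atTop :=
      tendsto_atTop_mono (fun k => by dsimp only [id]; omega) tendsto_id
    simpa [h] using ((hg x).comp h2).sub ((hg x).comp h1)
  have hest : ∀ (n : ℕ) (w : ℕ → ℝ), a * (2 * ∑ k ∈ Finset.range n, |w k|) ≤
      ‖∑ k ∈ Finset.range n, w k • h k‖ := by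
    intro n w
    let d : ℕ → ℝ := fun i => if Even i then -w (i / 2) else w (i / 2)
    have h1 : ∀ k, d (2 * k) = -w k := fun k => by simp [d]
    have h2 : ∀ k, d (2 * k + 1) = w k := fun k => by
      have : (2 * k + 1) / 2 = k := by omega
      simp [d, this]
    have := hf (Finset.range (2 * n)) d
    rw [sum_range_two_mul, sum_range_two_mul] at this
    simp only [h1, h2, abs_neg, ← two_mul, ← Finset.mul_sum] at this
    convert this using 3 with k
    simp only [h, smul_sub, neg_smul]
    abel
  let T : Set C(X, ℝ) := {c | ∃ w : ℕ →₀ ℝ, (∀ k, 0 ≤ w k) ∧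
    Finsupp.linearCombination ℝ (fun _ => (1 : ℝ)) w = 1 ∧
    ∀ x, |Finsupp.linearCombination ℝ h w x| ≤ c x}
  have hT : Convex ℝ T := by
    rintro c ⟨w, hw0, hw1, hwc⟩ d ⟨v, hv0, hv1, hvd⟩ α β hα hβ hαβ
    refine ⟨α • w + β • v, fun k => ?_, by simp only [map_add, map_smul, hw1, hv1]; simpa, ?_⟩
    · simpa using add_nonneg (mul_nonneg hα (hw0 k)) (mul_nonneg hβ (hv0 k))
    · intro x
      simp only [map_add, map_smul, ContinuousMap.add_apply, ContinuousMap.smul_apply, smul_eq_mul]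
      refine (abs_add_le _ _).trans (add_le_add ?_ ?_)
      · rw [abs_mul, abs_of_nonneg hα]
        exact mul_le_mul_of_nonneg_left (hwc x) hα
      · rw [abs_mul, abs_of_nonneg hβ]
        exact mul_le_mul_of_nonneg_left (hvd x) hβ
  have hmem : ∀ k, |h k| ∈ T := by
    refine fun k => ⟨Finsupp.single k 1, fun j => ?_, by simp, fun x => by simp⟩
    exact (Finsupp.single_nonneg.2 zero_le_one : (0 : ℕ →₀ ℝ) ≤ Finsupp.single k 1) j
  obtain ⟨c, ⟨w, hw0, hw1, hwc⟩, hc⟩ := exists_forall_lt_of_convex_of_tendsto_zero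
    (h := fun k => |h k|) (C := C + C)
    (fun k x => by
      simpa [h] using (abs_sub _ _).trans (add_le_add (hC (2 * k + 1) x) (hC (2 * k) x)))
    (fun x => by simpa using (hlim x).abs) hT hmem ha
  have hsub : w.support ⊆ Finset.range (w.support.sup id + 1) := fun j hj =>
    Finset.mem_range.2 (Nat.lt_succ_of_le (Finset.le_sup (f := id) hj))
  rw [Finsupp.linearCombination_apply, Finsupp.sum_of_support_subset _ hsub _ (by simp)] at hw1
  have hle := hest (w.support.sup id + 1) w
  have hnorm : ‖Finsupp.linearCombination ℝ h w‖ ≤ a :=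
    (ContinuousMap.norm_le _ ha.le).2 fun x => (hwc x).trans (hc x).le
  rw [Finsupp.linearCombination_apply, Finsupp.sum_of_support_subset _ hsub _ (by simp)] at hnorm
  simp only [abs_of_nonneg (hw0 _)] at hle
  simp only [smul_eq_mul, mul_one] at hw1
  rw [hw1] at hle
  linarith

/-- Characterizations of tame (bounded) families of continuous functions on a compact
space: no `l₁`-sequence ↔ no independent sequence ↔ pointwise sequential precompactness
↔ all pointwise cluster functions are fragmented. -/
theorem tame_family_characterization {X : Type*} [TopologicalSpace X] [CompactSpace X]
    [T2Space X] (F : Set C(X, ℝ)) (hb : ∃ M : ℝ, ∀ f ∈ F, ∀ x : X, |f x| ≤ M) :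
    ((¬ ∃ f : ℕ → C(X, ℝ), (∀ n, f n ∈ F) ∧ ∃ a : ℝ, 0 < a ∧
        ∀ (n : ℕ) (c : ℕ → ℝ),
          a * ∑ i ∈ Finset.range n, |c i| ≤ ‖∑ i ∈ Finset.range n, c i • f i‖) ↔
      (¬ ∃ f : ℕ → C(X, ℝ), (∀ n, f n ∈ F) ∧
        IndependentSeq (fun n => (f n : X → ℝ)))) ∧
    ((¬ ∃ f : ℕ → C(X, ℝ), (∀ n, f n ∈ F) ∧
        IndependentSeq (fun n => (f n : X → ℝ))) ↔
      (∀ f : ℕ → C(X, ℝ), (∀ n, f n ∈ F) → ∃ φ : ℕ → ℕ, StrictMono φ ∧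
        ∃ g : X → ℝ, ∀ x : X, Tendsto (fun k => f (φ k) x) atTop (𝓝 (g x)))) ∧
    ((∀ f : ℕ → C(X, ℝ), (∀ n, f n ∈ F) → ∃ φ : ℕ → ℕ, StrictMono φ ∧
        ∃ g : X → ℝ, ∀ x : X, Tendsto (fun k => f (φ k) x) atTop (𝓝 (g x))) ↔
      (∀ g : X → ℝ, g ∈ closure ((fun f : C(X, ℝ) => (f : X → ℝ)) '' F) →
        FragmentedR g)) := by
  obtain ⟨C, hC⟩ := hb
  have ros : (¬ ∃ f : ℕ → C(X, ℝ), (∀ n, f n ∈ F) ∧ IndependentSeq (fun n => (f n : X → ℝ))) →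
      ∀ f : ℕ → C(X, ℝ), (∀ n, f n ∈ F) → ∃ φ : ℕ → ℕ, StrictMono φ ∧
        ∃ g : X → ℝ, ∀ x : X, Tendsto (fun k => f (φ k) x) atTop (𝓝 (g x)) := by
    intro h f hf
    refine (exists_independentSeq_or_tendsto fun n x => hC _ (hf n) x).resolve_left ?_
    rintro ⟨φ, -, hφ⟩
    exact h ⟨fun n => f (φ n), fun n => hf _, hφ⟩
  have noEll : (∀ f : ℕ → C(X, ℝ), (∀ n, f n ∈ F) → ∃ φ : ℕ → ℕ, StrictMono φ ∧
        ∃ g : X → ℝ, ∀ x : X, Tendsto (fun k => f (φ k) x) atTop (𝓝 (g x))) →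
      ¬ ∃ f : ℕ → C(X, ℝ), (∀ n, f n ∈ F) ∧ ∃ a : ℝ, 0 < a ∧ ∀ (n : ℕ) (c : ℕ → ℝ),
          a * ∑ i ∈ Finset.range n, |c i| ≤ ‖∑ i ∈ Finset.range n, c i • f i‖ := by
    rintro h ⟨f, hf, a, ha, hfa⟩
    obtain ⟨φ, hφ, g, hg⟩ := h f hf
    exact not_sum_abs_le_norm_of_tendsto (f := fun k => f (φ k)) (fun n x => hC _ (hf _) x) hg ha
      (sum_abs_le_norm_comp_of_injective hfa hφ.injective)
  have noInd : (¬ ∃ f : ℕ → C(X, ℝ), (∀ n, f n ∈ F) ∧ ∃ a : ℝ, 0 < a ∧ ∀ (n : ℕ) (c : ℕ → ℝ),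
          a * ∑ i ∈ Finset.range n, |c i| ≤ ‖∑ i ∈ Finset.range n, c i • f i‖) →
      ¬ ∃ f : ℕ → C(X, ℝ), (∀ n, f n ∈ F) ∧ IndependentSeq (fun n => (f n : X → ℝ)) :=
    fun h ⟨f, hf, hind⟩ => h ⟨f, hf, hind.exists_mul_sum_abs_le_norm⟩
  have frag : (¬ ∃ f : ℕ → C(X, ℝ), (∀ n, f n ∈ F) ∧
        IndependentSeq (fun n => (f n : X → ℝ))) ↔
      ∀ g : X → ℝ, g ∈ closure ((fun f : C(X, ℝ) => (f : X → ℝ)) '' F) → FragmentedR g := by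
    refine ⟨fun h g hg => ?_, ?_⟩
    · by_contra hfrag
      have hbound : closure ((fun f : C(X, ℝ) => (f : X → ℝ)) '' F) ⊆ {p | ∀ x, |p x| ≤ C} := by
        refine closure_minimal (Set.image_subset_iff.2 hC) ?_
        rw [Set.ofPred_forall]
        exact isClosed_iInter fun x => isClosed_le (continuous_apply x).abs continuous_const
      exact h (exists_independentSeq_of_not_fragmentedR (hbound hg) hg hfrag)
    · rintro h ⟨f, hf, hind⟩
      obtain ⟨g, hg, hfrag⟩ := hind.exists_not_fragmentedR (fun n => (f n).continuous)
        fun n => hC _ (hf n)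
      refine hfrag (h g (closure_mono ?_ hg))
      rintro _ ⟨n, rfl⟩
      exact ⟨f n, hf n, rfl⟩
  exact ⟨⟨noInd, noEll ∘ ros⟩, ⟨ros, noInd ∘ noEll⟩, ⟨frag.1 ∘ noInd ∘ noEll, ros ∘ frag.2⟩⟩
end

section
/- Let F be a uniformly bounded family of real-valued (not necessarily continuous) functions on a set X that has the double limit property: for every sequence (f_n) in F and every sequence (x_m) in X, the iterated limits lim_n lim_m f_n(x_m) and lim_m lim_n f_n(x_m) are equal whenever both exist. Then F is tame, i.e., F contains no independent sequence. -/
open Filter Topology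

/-- A uniformly bounded sequence of real functions on a countable set has a pointwise convergent
subsequence. -/
theorem exists_subseq_tendsto_pointwise {ι : Type*} [Countable ι] {M : ℝ} (u : ℕ → ι → ℝ)
    (hu : ∀ n i, |u n i| ≤ M) :
    ∃ (l : ι → ℝ) (φ : ℕ → ℕ), StrictMono φ ∧
      ∀ i, Tendsto (fun n => u (φ n) i) atTop (𝓝 (l i)) := by
  have hK : IsCompact (Set.univ.pi fun _ : ι => Set.Icc (-M) M) :=
    isCompact_univ_pi fun _ => isCompact_Icc
  obtain ⟨l, -, φ, hφ, hl⟩ := hK.tendsto_subseq (x := u) fun n i _ => abs_le.mp (hu n i)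
  exact ⟨l, φ, hφ, tendsto_pi_nhds.mp hl⟩

/-- Under the double limit property, if `h n (x m)` converges to `g m` as `n → ∞`, then along
subsequences both iterated limits exist and agree. -/
theorem exists_common_iterated_limit {X : Type*} {F : Set (X → ℝ)} {M : ℝ}
    (hM : ∀ f ∈ F, ∀ x : X, |f x| ≤ M)
    (hdlp : ∀ f : ℕ → X → ℝ, (∀ n, f n ∈ F) → ∀ x : ℕ → X, ∀ L₁ L₂ : ℝ,
      (∃ l : ℕ → ℝ, (∀ n, Tendsto (fun m => f n (x m)) atTop (𝓝 (l n))) ∧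
        Tendsto l atTop (𝓝 L₁)) →
      (∃ l' : ℕ → ℝ, (∀ m, Tendsto (fun n => f n (x m)) atTop (𝓝 (l' m))) ∧
        Tendsto l' atTop (𝓝 L₂)) →
      L₁ = L₂)
    {h : ℕ → X → ℝ} (hF : ∀ n, h n ∈ F) {x : ℕ → X} {g : ℕ → ℝ}
    (hg : ∀ m, Tendsto (fun n => h n (x m)) atTop (𝓝 (g m))) :
    ∃ (σ τ : ℕ → ℕ) (l : ℕ → ℝ) (L : ℝ), StrictMono σ ∧ StrictMono τ ∧
      (∀ n, Tendsto (fun m => h n (x (σ m))) atTop (𝓝 (l n))) ∧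
      Tendsto (fun n => l (τ n)) atTop (𝓝 L) ∧ Tendsto (fun m => g (σ m)) atTop (𝓝 L) := by
  have hgM : ∀ m, |g m| ≤ M := fun m => le_of_tendsto' (hg m).abs fun n => hM _ (hF n) _
  obtain ⟨l, σ₁, hσ₁, hl⟩ :=
    exists_subseq_tendsto_pointwise (fun m n => h n (x m)) fun m n => hM _ (hF n) _
  obtain ⟨L₂, σ₂, hσ₂, hL₂⟩ :=
    exists_subseq_tendsto_pointwise (fun m (_ : Unit) => g (σ₁ m)) fun m _ => hgM _
  have hlM : ∀ n, |l n| ≤ M := fun n => le_of_tendsto' (hl n).abs fun m => hM _ (hF n) _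
  obtain ⟨L₁, τ, hτ, hL₁⟩ :=
    exists_subseq_tendsto_pointwise (fun n (_ : Unit) => l n) fun n _ => hlM n
  have hl' : ∀ n, Tendsto (fun m => h n (x (σ₁ (σ₂ m)))) atTop (𝓝 (l n)) :=
    fun n => (hl n).comp hσ₂.tendsto_atTop
  have hL : L₁ () = L₂ () :=
    hdlp (fun n => h (τ n)) (fun n => hF _) (fun m => x (σ₁ (σ₂ m))) _ _
      ⟨fun n => l (τ n), fun n => hl' _, hL₁ ()⟩
      ⟨fun m => g (σ₁ (σ₂ m)), fun m => (hg _).comp hτ.tendsto_atTop, hL₂ ()⟩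
  exact ⟨σ₁ ∘ σ₂, τ, l, L₁ (), hσ₁.comp hσ₂, hτ, hl', hL₁ (), hL ▸ hL₂ ()⟩

/-- A uniformly bounded family of real-valued functions with the double limit
property is tame (contains no independent sequence). -/
theorem dlp_implies_tame {X : Type*} (F : Set (X → ℝ))
    (hb : ∃ M : ℝ, ∀ f ∈ F, ∀ x : X, |f x| ≤ M)
    (hdlp : ∀ f : ℕ → X → ℝ, (∀ n, f n ∈ F) → ∀ x : ℕ → X, ∀ L₁ L₂ : ℝ,
      (∃ l : ℕ → ℝ, (∀ n, Tendsto (fun m => f n (x m)) atTop (𝓝 (l n))) ∧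
        Tendsto l atTop (𝓝 L₁)) →
      (∃ l' : ℕ → ℝ, (∀ m, Tendsto (fun n => f n (x m)) atTop (𝓝 (l' m))) ∧
        Tendsto l' atTop (𝓝 L₂)) →
      L₁ = L₂) :
    ¬ ∃ f : ℕ → X → ℝ, (∀ n, f n ∈ F) ∧ IndependentSeq f := by
  rintro ⟨f, hfF, a, b, hab, hind⟩
  obtain ⟨M, hM⟩ := hb
  have hy : ∀ m k : ℕ, ∃ y : X, (∀ n ≤ m, f n y < a) ∧ ∀ n, m < n → n ≤ k → b < f n y := by
    intro m k
    obtain ⟨y, hy₁, hy₂⟩ := hind (Finset.Iic m) (Finset.Ioc m k) <| by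
      rw [Finset.disjoint_left]
      intro n hn hn'
      simp only [Finset.mem_Iic, Finset.mem_Ioc] at hn hn'
      omega
    simp only [Set.mem_iInter, Set.mem_preimage, Finset.mem_Iic, Finset.mem_Ioc, Set.mem_Iio,
      Set.mem_Ioi] at hy₁ hy₂
    exact ⟨y, hy₁, fun n h₁ h₂ => hy₂ n ⟨h₁, h₂⟩⟩
  choose y hya hyb using hy
  obtain ⟨g, φ, hφ, hg⟩ := exists_subseq_tendsto_pointwise
    (fun n (p : ℕ × ℕ) => f n (y p.1 p.2)) fun n p => hM _ (hfF n) _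
  obtain ⟨c, hac, hcb⟩ := exists_between hab
  have hk : ∀ m, ∃ k, c < g (m, k) := by
    intro m
    obtain ⟨σ, τ, l, L, hσ, hτ, hl, hlL, hgL⟩ := exists_common_iterated_limit hM hdlp
      (fun n => hfF (φ n)) (x := y m) fun k => hg (m, k)
    have hbL : b ≤ L := by
      refine ge_of_tendsto hlL ?_
      filter_upwards [(hφ.comp hτ).tendsto_atTop.eventually_gt_atTop m] with n hn
      refine ge_of_tendsto (hl (τ n)) ?_
      filter_upwards [hσ.tendsto_atTop.eventually_ge_atTop (φ (τ n))] with k hk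
      exact (hyb m (σ k) _ hn hk).le
    obtain ⟨k, hk⟩ := (hgL.eventually_const_lt (hcb.trans_le hbL)).exists
    exact ⟨σ k, hk⟩
  choose k hk using hk
  obtain ⟨σ, τ, l, L, hσ, -, hl, hlL, hgL⟩ := exists_common_iterated_limit hM hdlp
    (fun n => hfF (φ n)) (x := fun m => y m (k m)) fun m => hg (m, k m)
  have hLa : L ≤ a := by
    refine le_of_tendsto' hlL fun n => le_of_tendsto (hl (τ n)) ?_
    filter_upwards [hσ.tendsto_atTop.eventually_ge_atTop (φ (τ n))] with m hm
    exact (hya (σ m) _ _ hm).le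
  have hcL : c ≤ L := ge_of_tendsto' hgL fun m => (hk (σ m)).le
  exact (hac.trans_le (hcL.trans hLa)).false
end

section
/- Let (X, τ, ≤) be a compact Hausdorff topological space with a linear order ≤ whose graph is closed in X × X. Then τ coincides with the interval (order) topology of ≤. -/
theorem Continuous.eq_induced_of_injective {X Y : Type*} [tX : TopologicalSpace X]
    [tY : TopologicalSpace Y] [CompactSpace X] [T2Space Y] {f : X → Y} (hf : Continuous f)
    (hinj : Function.Injective f) : tX = tY.induced f :=
  (hf.isClosedEmbedding hinj).isEmbedding.isInducing.eq_induced

/-- A compact topology finer than a Hausdorff topology is equal to it. -/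
theorem TopologicalSpace.eq_of_le_of_compactSpace_of_t2Space {X : Type*}
    {t s : TopologicalSpace X} (ht : @CompactSpace X t) (hs : @T2Space X s) (hle : t ≤ s) :
    t = s :=
  (@Continuous.eq_induced_of_injective X X t s ht hs id (continuous_id_iff_le.2 hle)
    Function.injective_id).trans (@induced_id X s)

/-- If a compact Hausdorff topology makes the graph of a linear order closed, then
the topology coincides with the interval (order) topology of the order. -/
theorem compact_closed_linear_order_is_order_topology {X : Type*} [TopologicalSpace X]
    [CompactSpace X] [T2Space X] [LinearOrder X]
    (h : IsClosed {p : X × X | p.1 ≤ p.2}) :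
    OrderTopology X := by
  have : OrderClosedTopology X := ⟨h⟩
  have hT2 : @T2Space X (Preorder.topology X) :=
    let _ := Preorder.topology X
    have : OrderTopology X := ⟨rfl⟩
    inferInstance
  refine ⟨TopologicalSpace.eq_of_le_of_compactSpace_of_t2Space ‹_› hT2 (le_generateFrom ?_)⟩
  rintro s ⟨a, rfl | rfl⟩
  · exact isOpen_Ioi
  · exact isOpen_Iio
end

section
/- (Nachbin) Let (Y, τ, ≤) be a compact ordered space, i.e., (Y, τ) is compact Hausdorff and ≤ is a partial order on Y whose graph is closed in Y × Y. Then the continuous order preserving functions Y → [0,1] separate the points of Y: for any two distinct points y_1, y_2 ∈ Y there exists a continuous function f : Y → [0,1] with f order preserving and f(y_1) ≠ f(y_2). -/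
/-- In a compact Hausdorff space with closed order, the upper closure of a closed set is closed. -/
theorem IsClosed.upperClosure_of_compactSpace {X : Type*} [TopologicalSpace X] [CompactSpace X]
    [T2Space X] [Preorder X] [OrderClosedTopology X] {s : Set X} (hs : IsClosed s) :
    IsClosed (upperClosure s : Set X) := by
  have h : (upperClosure s : Set X) = Prod.snd '' ({p : X × X | p.1 ≤ p.2} ∩ Prod.fst ⁻¹' s) := by
    ext x
    simp [mem_upperClosure, and_comm]
  rw [h]
  exact ((OrderClosedTopology.isClosed_le'.inter
    (hs.preimage continuous_fst)).isCompact.image continuous_snd).isClosed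

/-- In a compact Hausdorff space with closed order, the lower closure of a closed set is closed. -/
theorem IsClosed.lowerClosure_of_compactSpace {X : Type*} [TopologicalSpace X] [CompactSpace X]
    [T2Space X] [Preorder X] [OrderClosedTopology X] {s : Set X} (hs : IsClosed s) :
    IsClosed (lowerClosure s : Set X) :=
  have : CompactSpace Xᵒᵈ := ‹CompactSpace X›
  have : T2Space Xᵒᵈ := ‹T2Space X›
  IsClosed.upperClosure_of_compactSpace (X := Xᵒᵈ) hs

/-- Normality with respect to lower sets: between a closed set and an open lower set containing it
there is an open lower set together with its closure. -/
theorem IsLowerSet.exists_isOpen_closure_subset {X : Type*} [TopologicalSpace X] [CompactSpace X]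
    [T2Space X] [Preorder X] [OrderClosedTopology X] {c u : Set X} (hu : IsLowerSet u)
    (hc : IsClosed c) (hu_open : IsOpen u) (hcu : c ⊆ u) :
    ∃ v : Set X, IsOpen v ∧ c ⊆ v ∧ closure v ⊆ u ∧ IsLowerSet v := by
  obtain ⟨w, w_open, hcw, hwu⟩ := normal_exists_closure_subset hc.lowerClosure_of_compactSpace
    hu_open (lowerClosure_min hcu hu)
  refine ⟨(upperClosure wᶜ : Set X)ᶜ,
    w_open.isClosed_compl.upperClosure_of_compactSpace.isOpen_compl,
    fun x hx hxw => ?_, (closure_mono ?_).trans hwu, (upperClosure wᶜ).upper.compl⟩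
  · obtain ⟨y, hyw, hyx⟩ := mem_upperClosure.1 hxw
    exact hyw (hcw (mem_lowerClosure.2 ⟨x, hx, hyx⟩))
  · exact Set.compl_subset_comm.1 subset_upperClosure

theorem Urysohns.CU.monotone_approx {X : Type*} [TopologicalSpace X] [Preorder X]
    (c : Urysohns.CU fun _ u : Set X => IsLowerSet u) (n : ℕ) : Monotone (c.approx n) := by
  induction n generalizing c with
  | zero =>
    intro x y hxy
    by_cases hy : y ∈ c.U
    · simp [Urysohns.CU.approx, hy, c.P_C_U hxy hy]
    · rw [c.approx_of_notMem_U 0 hy]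
      exact c.approx_le_one 0 x
  | succ n ih => exact fun _ _ hxy => midpoint_le_midpoint (ih c.left hxy) (ih c.right hxy)

theorem Urysohns.CU.monotone_lim {X : Type*} [TopologicalSpace X] [Preorder X]
    (c : Urysohns.CU fun _ u : Set X => IsLowerSet u) : Monotone c.lim :=
  fun _ y hxy => ciSup_mono (c.bddAbove_range_approx y) fun n => c.monotone_approx n hxy

/-- In a compact Hausdorff space with closed order, if `¬ a ≤ b` then some continuous monotone
function into `[0, 1]` vanishes at `b` and equals one at `a`. -/
theorem exists_continuous_monotone_zero_one_of_not_le {X : Type*} [TopologicalSpace X]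
    [CompactSpace X] [T2Space X] [Preorder X] [OrderClosedTopology X] {a b : X} (hab : ¬ a ≤ b) :
    ∃ f : X → ℝ, Continuous f ∧ Monotone f ∧ (∀ x, f x ∈ Set.Icc (0 : ℝ) 1) ∧
      f b = 0 ∧ f a = 1 := by
  let c : Urysohns.CU fun _ u : Set X => IsLowerSet u :=
    { C := {b}
      U := (Set.Ici a)ᶜ
      P_C_U := (isUpperSet_Ici a).compl
      closed_C := isClosed_singleton
      open_U := isClosed_Ici.isOpen_compl
      subset := Set.singleton_subset_iff.2 hab
      hP := fun hc hu hu_open hcu => by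
        obtain ⟨v, v_open, hcv, hvu, hv⟩ := hu.exists_isOpen_closure_subset hc hu_open hcu
        exact ⟨v, v_open, hcv, hvu, hv, hu⟩ }
  exact ⟨c.lim, c.continuous_lim, c.monotone_lim, c.lim_mem_Icc, c.lim_of_mem_C b rfl,
    c.lim_of_notMem_U a fun h => h le_rfl⟩

/-- (Nachbin) On a compact ordered space, the continuous order preserving functions
into `[0,1]` separate the points. -/
theorem nachbin_separation {Y : Type*} [TopologicalSpace Y] [CompactSpace Y]
    [T2Space Y] [PartialOrder Y] (hcl : IsClosed {p : Y × Y | p.1 ≤ p.2}) :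
    ∀ y₁ y₂ : Y, y₁ ≠ y₂ → ∃ f : Y → ℝ, Continuous f ∧ Monotone f ∧
      (∀ y, f y ∈ Set.Icc (0 : ℝ) 1) ∧ f y₁ ≠ f y₂ := by
  intro y₁ y₂ hne
  have : OrderClosedTopology Y := ⟨hcl⟩
  by_cases h : y₁ ≤ y₂
  · obtain ⟨f, hf, hmono, hmem, h₁, h₂⟩ :=
      exists_continuous_monotone_zero_one_of_not_le fun h' => hne (le_antisymm h h')
    exact ⟨f, hf, hmono, hmem, by simp [h₁, h₂]⟩
  · obtain ⟨f, hf, hmono, hmem, h₂, h₁⟩ := exists_continuous_monotone_zero_one_of_not_le h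
    exact ⟨f, hf, hmono, hmem, by simp [h₁, h₂]⟩
end

section
/- Let (X, ≤) be a linearly ordered set equipped with the interval (order) topology, and let (Y, τ, ≤) be a compact ordered space in the sense of Nachbin, equipped with its unique compatible uniformity. Then every order preserving map f : X → Y is fragmented. -/
open Filter Set Topology in
theorem Monotone.exists_tendsto_atTop_of_compactSpace {Y : Type*} [TopologicalSpace Y]
    [CompactSpace Y] [PartialOrder Y] [OrderClosedTopology Y] {s : ℕ → Y} (hs : Monotone s) :
    ∃ L, Tendsto s atTop (𝓝 L) := by
  have upper : ∀ L, MapClusterPt L atTop s → ∀ n, s n ≤ L := fun L hL n =>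
    isClosed_Ici.mem_of_mapClusterPt hL ((eventually_ge_atTop n).mono fun _ h => hs h)
  have least : ∀ L, MapClusterPt L atTop s → ∀ M, (∀ n, s n ≤ M) → L ≤ M := fun L hL M hM =>
    isClosed_Iic.mem_of_mapClusterPt hL (Eventually.of_forall hM)
  obtain ⟨L, hL⟩ := exists_clusterPt_of_compactSpace (map s atTop)
  refine ⟨L, tendsto_nhds_of_unique_mapClusterPt fun M hM => ?_⟩
  exact le_antisymm (least M hM L (upper L hL)) (least L hL M (upper M hM))

open Filter Set Topology in
/-- A monotone map into a compact ordered space cannot oscillate by a fixed entourage on each of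
infinitely many consecutive intervals. -/
theorem exists_mem_uniformity_of_interlaced {Y : Type*} [UniformSpace Y] [CompactSpace Y]
    [PartialOrder Y] [OrderClosedTopology Y] {s t : ℕ → Y} (hst : ∀ n, s n ≤ t n)
    (hts : ∀ n, t n ≤ s (n + 1)) {ε : Set (Y × Y)} (hε : ε ∈ uniformity Y) :
    ∃ n, (s n, t n) ∈ ε := by
  obtain ⟨L, hL⟩ := (monotone_nat_of_le_succ fun n =>
    (hst n).trans (hts n)).exists_tendsto_atTop_of_compactSpace
  obtain ⟨M, hM⟩ := (monotone_nat_of_le_succ fun n =>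
    (hts n).trans (hst (n + 1))).exists_tendsto_atTop_of_compactSpace
  have hLM : L = M := le_antisymm (le_of_tendsto_of_tendsto' hL hM hst)
    (le_of_tendsto_of_tendsto' hM (hL.comp (tendsto_add_atTop_nat 1)) hts)
  subst hLM
  exact ((hL.prodMk_nhds hM).eventually (nhds_le_uniformity L hε)).exists

open Set in
/-- If every nonempty relatively open piece of `A` contains two points in strict order related by
`r`, then in each order interval meeting `A` they can be found with further points of `A` between
them and the right endpoint. -/
theorem exists_pair_with_remaining_points {X : Type*} [LinearOrder X] [TopologicalSpace X]
    [OrderTopology X] {A : Set X} {r : X → X → Prop}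
    (h : ∀ O : Set X, IsOpen O → (O ∩ A).Nonempty → ∃ x ∈ O ∩ A, ∃ y ∈ O ∩ A, x < y ∧ r x y)
    {a c : X} (hac : (Ioo a c ∩ A).Nonempty) :
    ∃ x y, a < x ∧ x < y ∧ r x y ∧ (Ioo y c ∩ A).Nonempty := by
  obtain ⟨x, ⟨hx, hxA⟩, y, ⟨hy, hyA⟩, hxy, hr⟩ := h _ isOpen_Ioo hac
  by_cases hyc : (Ioo y c ∩ A).Nonempty
  · exact ⟨x, y, hx.1, hxy, hr, hyc⟩
  have below : ∀ z, z < y → (Ioo z y ∩ A).Nonempty := by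
    intro z hz
    obtain ⟨u, ⟨hu, huA⟩, v, ⟨hv, hvA⟩, huv, -⟩ :=
      h (Ioo z c) isOpen_Ioo ⟨y, ⟨hz, hy.2⟩, hyA⟩
    refine ⟨u, ⟨hu.1, huv.trans_le ?_⟩, huA⟩
    exact not_lt.1 fun hyv => hyc ⟨v, ⟨hyv, hv.2⟩, hvA⟩
  obtain ⟨u, ⟨hu, -⟩, v, ⟨hv, -⟩, huv, hr'⟩ := h _ isOpen_Ioo (below x hxy)
  obtain ⟨w, hw, hwA⟩ := below v hv.2
  exact ⟨u, v, hx.1.trans hu.1, huv, hr', w, ⟨hw.1, hw.2.trans hy.2⟩, hwA⟩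

/-- Every order preserving map from a linearly ordered set (with its interval
topology) into a compact ordered space (with its unique compatible uniformity)
is fragmented. -/
theorem monotone_map_is_fragmented {X : Type*} [LinearOrder X] [TopologicalSpace X]
    [OrderTopology X] {Y : Type*} [UniformSpace Y] [CompactSpace Y] [T2Space Y]
    [PartialOrder Y] (hcl : IsClosed {p : Y × Y | p.1 ≤ p.2})
    (f : X → Y) (hf : Monotone f) :
    ∀ A : Set X, A.Nonempty → ∀ ε ∈ uniformity Y, ∃ O : Set X, IsOpen O ∧
      (O ∩ A).Nonempty ∧ ∀ x ∈ O ∩ A, ∀ y ∈ O ∩ A, (f x, f y) ∈ ε := by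
  intro A hA ε hε
  have : OrderClosedTopology Y := ⟨hcl⟩
  obtain ⟨δ, hδ, hsymm, hδε⟩ := symm_of_uniformity hε
  by_contra hcon
  have h : ∀ O : Set X, IsOpen O → (O ∩ A).Nonempty →
      ∃ x ∈ O ∩ A, ∃ y ∈ O ∩ A, x < y ∧ (f x, f y) ∉ δ := by
    intro O hO hOA
    by_contra! hsmall
    refine hcon ⟨O, hO, hOA, fun x hx y hy => hδε ?_⟩
    rcases lt_trichotomy x y with hxy | rfl | hxy
    · exact hsmall x hx y hy hxy
    · exact refl_mem_uniformity hδ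
    · exact hsymm.symm _ _ (hsmall y hy x hx hxy)
  obtain ⟨a, c, hac⟩ : ∃ a c, (Set.Ioo a c ∩ A).Nonempty := by
    obtain ⟨x, hx, y, hy, hxy, -⟩ := h Set.univ isOpen_univ (by simpa using hA)
    obtain ⟨u, hu, v, hv, huv, -⟩ := h (Set.Iio y) isOpen_Iio ⟨x, hxy, hx.2⟩
    exact ⟨u, y, v, ⟨huv, hv.1⟩, hv.2⟩
  choose p q hp hpq hr hq using fun z : {z // (Set.Ioo z c ∩ A).Nonempty} =>
    exists_pair_with_remaining_points (r := fun x y => (f x, f y) ∉ δ) h z.2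
  let z : ℕ → {z // (Set.Ioo z c ∩ A).Nonempty} :=
    fun n => Nat.rec ⟨a, hac⟩ (fun _ w => ⟨q w, hq w⟩) n
  obtain ⟨n, hn⟩ := exists_mem_uniformity_of_interlaced (s := fun n => f (p (z n)))
    (t := fun n => f (q (z n))) (fun n => hf (hpq _).le) (fun n => hf (hp (z (n + 1))).le) hδ
  exact hr _ hn
end

section
/- (Representation theorem) Let (X, ≤) be a linearly ordered set, let c < d be reals, and let {f_i : X → [c,d]}_{i∈I} be a family of order preserving (not necessarily continuous) functions. Then there exist: a linearly ordered set (Y, ≤) that is compact Hausdorff in its interval (order) topology, an order preserving injection ν : X → Y whose image is dense in Y, and a family {F_i : Y → [c,d]}_{i∈I} of order preserving functions continuous with respect to the interval topology of Y, such that f_i = F_i ∘ ν for all i ∈ I. -/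
/-- The closure of a chain is a chain when the order relation is closed. -/
protected theorem IsChain.closure {α : Type*} [TopologicalSpace α] [PartialOrder α]
    [OrderClosedTopology α] {s : Set α} (hs : IsChain (· ≤ ·) s) :
    IsChain (· ≤ ·) (closure s) := by
  have hclosed : ∀ a : α, IsClosed {b | a ≤ b ∨ b ≤ a} := fun a =>
    isClosed_Ici.union isClosed_Iic
  have hleft : ∀ a ∈ s, ∀ y ∈ closure s, a ≤ y ∨ y ≤ a := fun a ha y hy =>
    closure_minimal (fun b hb => hs.total ha hb) (hclosed a) hy
  exact fun x hx y hy _ =>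
    (closure_minimal (fun a ha => (hleft a ha y hy).symm) (hclosed y) hx).symm

/-- A compact topology on a linear order with closed order relation is the order topology. -/
theorem OrderTopology.of_compactSpace {α : Type*} [LinearOrder α] [t : TopologicalSpace α]
    [OrderClosedTopology α] [CompactSpace α] : OrderTopology α := by
  have hle : t ≤ Preorder.topology α := by
    refine le_generateFrom ?_
    rintro _ ⟨a, rfl | rfl⟩
    · exact isOpen_Ioi
    · exact isOpen_Iio
  have ht2 : @T2Space α (Preorder.topology α) := by
    let := Preorder.topology α
    have : OrderTopology α := ⟨rfl⟩
    infer_instance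
  refine ⟨le_antisymm hle fun u hu => ?_⟩
  have hclosedMap : @IsClosedMap α α t (Preorder.topology α) id :=
    @Continuous.isClosedMap α α t (Preorder.topology α) _ ht2 id (continuous_id_iff_le.2 hle)
  have := hclosedMap uᶜ hu.isClosed_compl
  rw [Set.image_id] at this
  simpa using this.isOpen_compl

/-- Representation theorem: any family of order preserving functions from a linearly
ordered set `X` into `[c,d]` extends, through an order preserving dense injection of
`X` into a compact LOTS `Y`, to a family of continuous order preserving functions
on `Y`. -/
theorem representation_theorem {X : Type} [LinearOrder X] {I : Type} {c d : ℝ}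
    (hcd : c < d) (f : I → X → ℝ) (hmono : ∀ i, Monotone (f i))
    (hrange : ∀ i x, f i x ∈ Set.Icc c d) :
    ∃ (Y : Type) (_ : LinearOrder Y) (_ : TopologicalSpace Y),
      OrderTopology Y ∧ CompactSpace Y ∧ T2Space Y ∧
      ∃ ν : X → Y, Function.Injective ν ∧ Monotone ν ∧ Dense (Set.range ν) ∧
        ∃ F : I → Y → ℝ, (∀ i, Continuous (F i)) ∧ (∀ i, Monotone (F i)) ∧
          (∀ i y, F i y ∈ Set.Icc c d) ∧ ∀ i, f i = F i ∘ ν := by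
  classical
  let e : X → X ⊕ I → ℝ := fun x => Sum.elim (fun a => if a ≤ x then 1 else 0) (f · x)
  have he : Monotone e := by
    rintro x y hxy (a | i)
    · by_cases h : a ≤ x
      · simp [e, h, h.trans hxy]
      · by_cases h' : a ≤ y <;> simp [e, h, h']
    · exact hmono i hxy
  have hinj : Function.Injective e := by
    have key : ∀ x y, e x = e y → x ≤ y := fun x y h => by
      simpa [e] using congrFun h (Sum.inl x)
    exact fun x y h => le_antisymm (key x y h) (key y x h.symm)
  let S := closure (Set.range e)
  have hS : S ⊆ Set.Icc (Sum.elim 0 fun _ => c) (Sum.elim 1 fun _ => d) := by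
    refine closure_minimal ?_ isClosed_Icc
    rintro _ ⟨x, rfl⟩
    constructor <;> rintro (a | i)
    · by_cases h : a ≤ x <;> simp [e, h]
    · exact (hrange i x).1
    · by_cases h : a ≤ x <;> simp [e, h]
    · exact (hrange i x).2
  have hchain : IsChain (· ≤ ·) (Set.range e) := he.isChain_range
  have hcompact : CompactSpace S :=
    isCompact_iff_compactSpace.1 (isCompact_Icc.of_isClosed_subset isClosed_closure hS)
  let : LinearOrder S :=
    { (inferInstance : PartialOrder S) with
      le_total := fun x y => hchain.closure.total x.2 y.2
      toDecidableLE := Classical.decRel _ }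
  have hclosed : OrderClosedTopology S :=
    ⟨isClosed_le (f := fun p : S × S => (p.1 : X ⊕ I → ℝ)) (g := fun p => p.2)
      (by fun_prop) (by fun_prop)⟩
  refine ⟨S, inferInstance, inferInstance, .of_compactSpace, hcompact, inferInstance,
    fun x => ⟨e x, subset_closure ⟨x, rfl⟩⟩, fun x y h => hinj (congrArg Subtype.val h),
    fun x y h => he h, ?_, fun i y => y.1 (Sum.inr i),
    fun i => (continuous_apply (Sum.inr i)).comp continuous_subtype_val,
    fun i x y h => h (Sum.inr i), fun i y => ⟨(hS y.2).1 (Sum.inr i), (hS y.2).2 (Sum.inr i)⟩,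
    fun i => rfl⟩
  intro y
  rw [closure_subtype, ← Set.range_comp]
  exact y.2
end

section
/- Let (X, ≤) be a linearly ordered set and c ≤ d reals, r > 0. Then BV_r(X,[c,d]), the set of all functions f : X → [c,d] whose variation is at most r, is a closed subset of the product space [c,d]^X with the product (pointwise convergence) topology; in particular it is compact. -/
/-- `f : X → [c,d]` has variation at most `r`. -/
def IccVarLE {X : Type*} [LinearOrder X] {c d : ℝ} (f : X → Set.Icc c d) (r : ℝ) : Prop :=
  ∀ (n : ℕ) (x : ℕ → X), (∀ i, x i ≤ x (i + 1)) →
    ∑ i ∈ Finset.range n, |(f (x (i + 1)) : ℝ) - (f (x i) : ℝ)| ≤ r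

/-- The functions of variation at most `r` form a closed set for pointwise convergence. -/
theorem isClosed_setOf_iccVarLE {X : Type*} [LinearOrder X] (c d r : ℝ) :
    IsClosed {f : X → Set.Icc c d | IccVarLE f r} := by
  simp only [IccVarLE, Set.ofPred_forall]
  refine isClosed_iInter fun n => isClosed_iInter fun x => isClosed_iInter fun _ => ?_
  exact isClosed_le (by fun_prop) continuous_const

/-- `BV_r(X,[c,d])` is closed (hence compact) in the product space `[c,d]^X`. -/
theorem bv_closed_compact {X : Type*} [LinearOrder X] {c d r : ℝ} (hcd : c ≤ d)
    (hr : 0 < r) :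
    IsClosed {f : X → Set.Icc c d | IccVarLE f r} ∧
    IsCompact {f : X → Set.Icc c d | IccVarLE f r} := by
  exact ⟨isClosed_setOf_iccVarLE c d r, (isClosed_setOf_iccVarLE c d r).isCompact⟩
end

section
/- (Analog of Jordan's decomposition) Let (X, ≤) be a linearly ordered set and let f : X → ℝ be a bounded function of bounded variation, i.e., there is r > 0 with Σ_{i=0}^{n-1} |f(x_{i+1}) − f(x_i)| ≤ r for every finite chain x_0 ≤ x_1 ≤ ⋯ ≤ x_n in X. Then f = u − v where u, v : X → ℝ are bounded order preserving functions. -/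
open Set in
/-- A uniform bound on the sums of increments along monotone sequences bounds the variation. -/
theorem eVariationOn_univ_le_ofReal {X : Type*} [LinearOrder X] {f : X → ℝ} {r : ℝ}
    (h : ∀ (n : ℕ) (x : ℕ → X), (∀ i, x i ≤ x (i + 1)) →
      ∑ i ∈ Finset.range n, |f (x (i + 1)) - f (x i)| ≤ r) :
    eVariationOn f univ ≤ ENNReal.ofReal r := by
  refine iSup_le fun ⟨n, x, hx, _⟩ => ?_
  simp only [edist_dist, Real.dist_eq]
  rw [← ENNReal.ofReal_sum_of_nonneg fun _ _ => abs_nonneg _]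
  exact ENNReal.ofReal_le_ofReal (h n x fun i => hx i.le_succ)

open Set in
/-- The increment of a function of bounded variation is dominated by the increment of its
variation on initial segments. -/
theorem BoundedVariationOn.abs_sub_le_toReal_Iic_sub {X : Type*} [LinearOrder X] {f : X → ℝ}
    (h : BoundedVariationOn f univ) {x y : X} (hxy : x ≤ y) :
    |f y - f x| ≤ (eVariationOn f (Iic y)).toReal - (eVariationOn f (Iic x)).toReal := by
  have hx := h.mono (subset_univ (Iic x))
  have hy := h.mono (subset_univ (Iic y))
  have hI := h.mono (subset_univ (Icc x y))
  have hadd := eVariationOn.add_le_union f (s := Iic x) (t := Icc x y)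
    fun _ ha _ hb => le_trans ha hb.1
  rw [Iic_union_Icc_eq_Iic hxy] at hadd
  have hreal := ENNReal.toReal_mono hy hadd
  rw [ENNReal.toReal_add hx hI] at hreal
  have hdist := hI.dist_le (right_mem_Icc.2 hxy) (left_mem_Icc.2 hxy)
  rw [Real.dist_eq] at hdist
  linarith


/-- Analog of Jordan's decomposition: every bounded real function of bounded
variation on a linearly ordered set is a difference of two bounded order
preserving functions. -/
theorem jordan_decomposition {X : Type*} [LinearOrder X] (f : X → ℝ)
    (hb : ∃ M : ℝ, ∀ x, |f x| ≤ M)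
    (hbv : ∃ r : ℝ, 0 < r ∧ ∀ (n : ℕ) (x : ℕ → X), (∀ i, x i ≤ x (i + 1)) →
      ∑ i ∈ Finset.range n, |f (x (i + 1)) - f (x i)| ≤ r) :
    ∃ u v : X → ℝ, Monotone u ∧ Monotone v ∧
      (∃ M : ℝ, ∀ x, |u x| ≤ M) ∧ (∃ M : ℝ, ∀ x, |v x| ≤ M) ∧ f = u - v := by
  obtain ⟨M, hM⟩ := hb
  obtain ⟨r, hr, hsum⟩ := hbv
  have hle := eVariationOn_univ_le_ofReal hsum
  have hbd : BoundedVariationOn f Set.univ := ne_top_of_le_ne_top ENNReal.ofReal_ne_top hle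
  let u : X → ℝ := fun x => (eVariationOn f (Set.Iic x)).toReal
  have hu (x : X) : |u x| ≤ r := by
    rw [abs_of_nonneg ENNReal.toReal_nonneg]
    exact ENNReal.toReal_le_of_le_ofReal hr.le ((eVariationOn.mono f (Set.subset_univ _)).trans hle)
  refine ⟨u, u - f, fun x y hxy => ?_, fun x y hxy => ?_, ⟨r, hu⟩, ⟨r + M, fun x => ?_⟩,
    (sub_sub_cancel u f).symm⟩
  · exact sub_nonneg.1 ((abs_nonneg _).trans (hbd.abs_sub_le_toReal_Iic_sub hxy))
  · have := (le_abs_self _).trans (hbd.abs_sub_le_toReal_Iic_sub hxy)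
    simp only [Pi.sub_apply, u]
    linarith
  · exact (abs_sub _ _).trans (add_le_add (hu x) (hM x))
end

section
/- Let X be a topological space. The set F(X) of all fragmented real-valued functions on X is a vector space over ℝ under pointwise operations: if f_1 and f_2 are fragmented then f_1 + f_2 is fragmented, and if f is fragmented and c ∈ ℝ then c·f is fragmented. -/
theorem FragmentedR.add {X : Type*} [TopologicalSpace X] {f g : X → ℝ}
    (hf : FragmentedR f) (hg : FragmentedR g) : FragmentedR (f + g) := by
  intro A hA ε hε
  obtain ⟨U, hU, hUA, hfU⟩ := hf A hA (ε / 2) (half_pos hε)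
  obtain ⟨V, hV, hVUA, hgV⟩ := hg (U ∩ A) hUA (ε / 2) (half_pos hε)
  refine ⟨V ∩ U, hV.inter hU, by rwa [Set.inter_assoc], fun x hx y hy => ?_⟩
  rw [Set.inter_assoc] at hx hy
  have hfxy := hfU x hx.2 y hy.2
  have hgxy := hgV x hx y hy
  calc |(f + g) x - (f + g) y| = |(f x - f y) + (g x - g y)| := by
        simp only [Pi.add_apply]; ring_nf
    _ ≤ |f x - f y| + |g x - g y| := abs_add_le _ _
    _ < ε := by linarith

theorem FragmentedR.const_smul {X : Type*} [TopologicalSpace X] {f : X → ℝ}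
    (hf : FragmentedR f) (c : ℝ) : FragmentedR (c • f) := by
  intro A hA ε hε
  have hc : 0 < |c| + 1 := by positivity
  obtain ⟨O, hO, hOA, hfO⟩ := hf A hA (ε / (|c| + 1)) (div_pos hε hc)
  refine ⟨O, hO, hOA, fun x hx y hy => ?_⟩
  have hfxy := (lt_div_iff₀ hc).1 (hfO x hx y hy)
  calc |(c • f) x - (c • f) y| = |c| * |f x - f y| := by
        rw [← abs_mul, mul_sub]; rfl
    _ < ε := by linarith [abs_nonneg (f x - f y)]

/-- The fragmented real-valued functions on a topological space form a vector space
over `ℝ` under pointwise operations. -/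
theorem fragmented_vector_space {X : Type*} [TopologicalSpace X] :
    (∀ f₁ f₂ : X → ℝ, FragmentedR f₁ → FragmentedR f₂ → FragmentedR (f₁ + f₂)) ∧
    (∀ (f : X → ℝ) (c : ℝ), FragmentedR f → FragmentedR (c • f)) :=
  ⟨fun _ _ hf hg => hf.add hg, fun _ c hf => hf.const_smul c⟩
end

section
/- Let (X, ≤) be a linearly ordered set, c ≤ d reals, and r > 0. Then the family BV_r(X,[c,d]) of all functions X → [c,d] with variation at most r is tame: it contains no independent sequence. In particular, the family M_+(X,[c,d]) of all order preserving functions X → [c,d] is tame. -/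
/-- If the points of a finite set are pairwise `δ`-separated by functions of variation at most `r`,
then the cardinality of the set is bounded linearly in the number of functions. -/
theorem RealVarLE.card_sub_one_mul_le {X ι : Type*} [LinearOrder X] {f : ι → X → ℝ} {r δ : ℝ}
    {s : Finset ι} (hf : ∀ n ∈ s, RealVarLE (f n) r) (T : Finset X) (hT : T.Nonempty)
    (hsep : ∀ x ∈ T, ∀ y ∈ T, x ≠ y → ∃ n ∈ s, δ ≤ |f n y - f n x|) :
    ((T.card : ℝ) - 1) * δ ≤ s.card * r := by
  obtain ⟨m, hm⟩ := Nat.exists_eq_add_one_of_ne_zero hT.card_pos.ne'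
  let e := T.orderEmbOfFin hm
  let y : ℕ → X := fun i => e ⟨min i m, by omega⟩
  have hy : ∀ i, y i ≤ y (i + 1) := fun i => e.monotone (by simp only [Fin.mk_le_mk]; omega)
  have hyT : ∀ i, y i ∈ T := fun i => T.orderEmbOfFin_mem hm _
  calc ((T.card : ℝ) - 1) * δ = ∑ i ∈ Finset.range m, δ := by simp [hm]
    _ ≤ ∑ i ∈ Finset.range m, ∑ n ∈ s, |f n (y (i + 1)) - f n (y i)| := by
        refine Finset.sum_le_sum fun i hi => ?_
        have hne : y i ≠ y (i + 1) := by
          intro h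
          have := Fin.mk.inj_iff.1 (e.injective h)
          have := Finset.mem_range.1 hi
          omega
        obtain ⟨n, hn, h⟩ := hsep _ (hyT i) _ (hyT (i + 1)) hne
        exact h.trans (Finset.single_le_sum
          (f := fun n => |f n (y (i + 1)) - f n (y i)|) (fun _ _ => abs_nonneg _) hn)
    _ = ∑ n ∈ s, ∑ i ∈ Finset.range m, |f n (y (i + 1)) - f n (y i)| := Finset.sum_comm
    _ ≤ ∑ n ∈ s, r := Finset.sum_le_sum fun n hn => hf n hn m y hy
    _ = s.card * r := by simp

theorem Monotone.realVarLE {X : Type*} [LinearOrder X] {f : X → ℝ} {c d : ℝ} (hf : Monotone f)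
    (hcd : ∀ x, f x ∈ Set.Icc c d) : RealVarLE f (d - c) := by
  intro n x hx
  calc ∑ i ∈ Finset.range n, |f (x (i + 1)) - f (x i)|
      = ∑ i ∈ Finset.range n, (f (x (i + 1)) - f (x i)) :=
        Finset.sum_congr rfl fun i _ => abs_of_nonneg (sub_nonneg.2 (hf (hx i)))
    _ = f (x n) - f (x 0) := Finset.sum_range_sub (fun i => f (x i)) n
    _ ≤ d - c := sub_le_sub (hcd _).2 (hcd _).1

theorem exists_nat_mul_lt_two_pow_sub_one_mul {r δ : ℝ} (hr : 0 ≤ r) (hδ : 0 < δ) :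
    ∃ N : ℕ, N * r < ((2 : ℝ) ^ N - 1) * δ := by
  have h := tendsto_pow_const_div_const_pow_of_one_lt 1 (one_lt_two (α := ℝ))
  have hpos : 0 < δ / (r + δ) := by positivity
  obtain ⟨N, hN, hN1⟩ :=
    ((h.eventually (gt_mem_nhds hpos)).and (Filter.eventually_ge_atTop 1)).exists
  refine ⟨N, ?_⟩
  rw [pow_one, div_lt_div_iff₀ (by positivity) (by positivity)] at hN
  have : (1 : ℝ) ≤ N := by exact_mod_cast hN1
  nlinarith

/-- A sequence of functions of uniformly bounded variation is not independent. -/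
theorem not_independentSeq_of_realVarLE {X : Type*} [LinearOrder X] {f : ℕ → X → ℝ} {r : ℝ}
    (hr : 0 ≤ r) (hf : ∀ n, RealVarLE (f n) r) : ¬ IndependentSeq f := by
  rintro ⟨a, b, hab, h⟩
  obtain ⟨N, hN⟩ := exists_nat_mul_lt_two_pow_sub_one_mul hr (sub_pos.2 hab)
  choose x hx using fun S : Finset ℕ => h S (Finset.range N \ S) Finset.disjoint_sdiff
  simp only [Set.mem_inter_iff, Set.mem_iInter, Set.mem_preimage, Set.mem_Iio, Set.mem_Ioi,
    Finset.mem_sdiff, Finset.mem_range] at hx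
  have hsep : ∀ S ∈ (Finset.range N).powerset, ∀ S' ∈ (Finset.range N).powerset, S ≠ S' →
      ∃ n ∈ Finset.range N, b - a ≤ |f n (x S') - f n (x S)| := by
    intro S hS S' hS' hne
    obtain ⟨n, hn⟩ : ∃ n, ¬ (n ∈ S ↔ n ∈ S') := by
      by_contra! hcon
      exact hne (Finset.ext hcon)
    by_cases hnS : n ∈ S
    · have hnS' : n ∉ S' := by tauto
      have hnN := Finset.mem_powerset.1 hS hnS
      refine ⟨n, hnN, le_abs.2 (Or.inl ?_)⟩
      linarith [(hx S).1 n hnS, (hx S').2 n ⟨Finset.mem_range.1 hnN, hnS'⟩]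
    · have hnS' : n ∈ S' := by tauto
      have hnN := Finset.mem_powerset.1 hS' hnS'
      refine ⟨n, hnN, le_abs.2 (Or.inr ?_)⟩
      linarith [(hx S').1 n hnS', (hx S).2 n ⟨Finset.mem_range.1 hnN, hnS⟩]
  have hinj : Set.InjOn x (Finset.range N).powerset := by
    intro S hS S' hS' heq
    by_contra hne
    obtain ⟨n, -, hn⟩ := hsep S hS S' hS' hne
    rw [heq, sub_self, abs_zero] at hn
    linarith
  have hle := RealVarLE.card_sub_one_mul_le (f := f) (δ := b - a) (s := Finset.range N)
    (fun n _ => hf n) ((Finset.range N).powerset.image x)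
    (Finset.Nonempty.image ⟨∅, Finset.empty_mem_powerset _⟩ x) (by
      simp only [Finset.forall_mem_image]
      exact fun S hS S' hS' hne => hsep S hS S' hS' (fun h => hne (h ▸ rfl)))
  rw [Finset.card_image_of_injOn hinj, Finset.card_powerset, Finset.card_range] at hle
  push_cast at hle
  linarith

/-- The family `BV_r(X,[c,d])` is tame: it contains no independent sequence.
In particular the family `M₊(X,[c,d])` of order preserving functions is tame. -/
theorem bv_family_is_tame {X : Type*} [LinearOrder X] {c d r : ℝ} (hcd : c ≤ d)
    (hr : 0 < r) :
    (¬ ∃ f : ℕ → X → ℝ,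
      (∀ n, (∀ x, f n x ∈ Set.Icc c d) ∧ RealVarLE (f n) r) ∧ IndependentSeq f) ∧
    (¬ ∃ f : ℕ → X → ℝ,
      (∀ n, (∀ x, f n x ∈ Set.Icc c d) ∧ Monotone (f n)) ∧ IndependentSeq f) := by
  constructor
  · rintro ⟨f, hf, hind⟩
    exact not_independentSeq_of_realVarLE hr.le (fun n => (hf n).2) hind
  · rintro ⟨f, hf, hind⟩
    exact not_independentSeq_of_realVarLE (sub_nonneg.2 hcd)
      (fun n => (hf n).2.realVarLE (hf n).1) hind
end

section
/- Let (X, ≤) be a linearly ordered set, c ≤ d reals, and r > 0. Then BV_r(X,[c,d]) is sequentially compact in the pointwise convergence topology: every sequence of functions f_n : X → [c,d] with variation at most r has a subsequence converging pointwise on X to a function f : X → [c,d] with variation at most r. -/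
open Filter Topology

/-- If monotone functions converge to `G` at every rational, then they converge to `G` at every
continuity point of `G`. -/
theorem tendsto_of_monotone_of_tendsto_rat {g : ℕ → ℝ → ℝ} (hg : ∀ n, Monotone (g n))
    {G : ℝ → ℝ} (hG : ∀ q : ℚ, Tendsto (fun n => g n q) atTop (𝓝 (G q))) {t : ℝ}
    (ht : ContinuousAt G t) : Tendsto (fun n => g n t) atTop (𝓝 (G t)) := by
  refine tendsto_order.2 ⟨fun l hl => ?_, fun u hu => ?_⟩
  · obtain ⟨ε, hε, hball⟩ := Metric.eventually_nhds_iff_ball.1 (ht.eventually_const_lt hl)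
    obtain ⟨q, hq, hqt⟩ := exists_rat_btwn (sub_lt_self t hε)
    have hlq : l < G q := hball q <| by
      rw [Real.ball_eq_Ioo]
      exact ⟨hq, by linarith⟩
    filter_upwards [(hG q).eventually_const_lt hlq] with n hn
    exact hn.trans_le (hg n hqt.le)
  · obtain ⟨ε, hε, hball⟩ := Metric.eventually_nhds_iff_ball.1 (ht.eventually_lt_const hu)
    obtain ⟨q, htq, hq⟩ := exists_rat_btwn (lt_add_of_pos_right t hε)
    have hqu : G q < u := hball q <| by
      rw [Real.ball_eq_Ioo]
      exact ⟨by linarith, hq⟩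
    filter_upwards [(hG q).eventually_lt_const hqu] with n hn
    exact (hg n htq.le).trans_lt hn

/-- **Helly's selection theorem** for monotone functions on the real line. -/
theorem exists_subseq_tendsto_of_monotone_real {a b : ℝ} (g : ℕ → ℝ → ℝ)
    (hg : ∀ n, Monotone (g n)) (hab : ∀ n t, g n t ∈ Set.Icc a b) :
    ∃ φ : ℕ → ℕ, StrictMono φ ∧ ∃ G : ℝ → ℝ,
      ∀ t, Tendsto (fun k => g (φ k) t) atTop (𝓝 (G t)) := by
  have hK : IsCompact (Set.univ.pi (fun _ : ℝ => Set.Icc a b) ∩ {h : ℝ → ℝ | Monotone h}) :=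
    (isCompact_univ_pi fun _ => isCompact_Icc).inter_right isClosed_monotone
  obtain ⟨G, ⟨-, hGmono⟩, hG⟩ := hK.exists_mapClusterPt (f := atTop) (u := g)
    (tendsto_principal.2 (Eventually.of_forall fun n => ⟨fun t _ => hab n t, hg n⟩))
  let D : Set ℝ := Set.range ((↑) : ℚ → ℝ) ∪ {t | ¬ContinuousAt G t}
  have : Countable D :=
    ((Set.countable_range _).union (Monotone.countable_not_continuousAt hGmono)).to_subtype
  have hGD : MapClusterPt (D.domRestrict G) atTop (D.domRestrict ∘ g) :=
    hG.continuousAt_comp (by fun_prop)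
  obtain ⟨φ, hφ, hlim⟩ := hGD.tendsto_subseq
  have hD : ∀ t ∈ D, Tendsto (fun k => g (φ k) t) atTop (𝓝 (G t)) := fun t ht =>
    tendsto_pi_nhds.1 hlim ⟨t, ht⟩
  refine ⟨φ, hφ, G, fun t => ?_⟩
  by_cases ht : ContinuousAt G t
  · exact tendsto_of_monotone_of_tendsto_rat (fun k => hg (φ k))
      (fun q => hD q (Or.inl ⟨q, rfl⟩)) ht
  · exact hD t (Or.inr ht)

/-- Countably many uniformly bounded monotone functions on a linear order all factor through a
single real-valued function, in an order-compatible way. -/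
theorem exists_real_le_imp_le_of_monotone {X : Type*} [LinearOrder X] {a b : ℝ} (f : ℕ → X → ℝ)
    (hf : ∀ n, Monotone (f n)) (hab : ∀ n x, f n x ∈ Set.Icc a b) :
    ∃ F : X → ℝ, ∀ n x y, F x ≤ F y → f n x ≤ f n y := by
  have hsum : ∀ x, Summable fun n => (1 / 2 : ℝ) ^ n * (f n x - a) := fun x =>
    (summable_geometric_two.mul_right (b - a)).of_nonneg_of_le
      (fun n => mul_nonneg (by positivity) (sub_nonneg.2 (hab n x).1))
      (fun n => by gcongr; exact (hab n x).2)
  refine ⟨fun x => ∑' n, (1 / 2 : ℝ) ^ n * (f n x - a), fun n x y => ?_⟩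
  contrapose!
  intro hlt
  refine Summable.tsum_lt_tsum (i := n) (fun m => ?_) ?_ (hsum y) (hsum x)
  · gcongr
    exact hf m ((hf n).reflect_lt hlt).le
  · gcongr

/-- **Helly's selection theorem** for monotone functions on an arbitrary linear order. -/
theorem exists_subseq_tendsto_of_monotone {X : Type*} [LinearOrder X] {a b : ℝ} (hle : a ≤ b)
    (f : ℕ → X → ℝ) (hf : ∀ n, Monotone (f n)) (hab : ∀ n x, f n x ∈ Set.Icc a b) :
    ∃ φ : ℕ → ℕ, StrictMono φ ∧ ∃ G : X → ℝ,
      ∀ x, Tendsto (fun k => f (φ k) x) atTop (𝓝 (G x)) := by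
  obtain ⟨F, hF⟩ := exists_real_le_imp_le_of_monotone f hf hab
  let S : ℕ → ℝ → Set ℝ := fun n t => insert a (f n '' {x | F x ≤ t})
  have hub : ∀ n t, b ∈ upperBounds (S n t) := by
    rintro n t _ (rfl | ⟨x, -, rfl⟩)
    exacts [hle, (hab n x).2]
  have hmono : ∀ n, Monotone fun t => sSup (S n t) := fun n s t hst =>
    csSup_le_csSup ⟨b, hub n t⟩ (Set.insert_nonempty _ _)
      (Set.insert_subset_insert (Set.image_mono fun x hx => le_trans hx hst))
  have hmem : ∀ n t, sSup (S n t) ∈ Set.Icc a b := fun n t =>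
    ⟨le_csSup ⟨b, hub n t⟩ (Set.mem_insert _ _), csSup_le (Set.insert_nonempty _ _) (hub n t)⟩
  have hfac : ∀ n x, sSup (S n (F x)) = f n x := by
    refine fun n x => IsGreatest.csSup_eq ⟨Or.inr ⟨x, le_refl (F x), rfl⟩, ?_⟩
    rintro _ (rfl | ⟨y, hy, rfl⟩)
    exacts [(hab n x).1, hF n y x hy]
  obtain ⟨φ, hφ, G, hG⟩ := exists_subseq_tendsto_of_monotone_real _ hmono hmem
  exact ⟨φ, hφ, fun x => G (F x), fun x => by simpa only [hfac] using hG (F x)⟩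

namespace RealVarLE

variable {X : Type*} [LinearOrder X] {r : ℝ}

theorem eVariationOn_le {f : X → ℝ} (h : RealVarLE f r) :
    eVariationOn f Set.univ ≤ ENNReal.ofReal r := by
  refine iSup_le fun p => ?_
  simp only [edist_dist, Real.dist_eq]
  rw [← ENNReal.ofReal_sum_of_nonneg fun _ _ => abs_nonneg _]
  exact ENNReal.ofReal_le_ofReal (h p.1 _ fun i => p.2.2.1 i.le_succ)

theorem of_tendsto_s17 {f : ℕ → X → ℝ} {g : X → ℝ} (h : ∀ n, RealVarLE (f n) r)
    (hlim : ∀ x, Tendsto (fun n => f n x) atTop (𝓝 (g x))) : RealVarLE g r := fun n x hx =>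
  le_of_tendsto' (tendsto_finsetSum _ fun i _ => ((hlim (x (i + 1))).sub (hlim (x i))).abs)
    fun k => h k n x hx

end RealVarLE

/-- Generalized Helly theorem: `BV_r(X,[c,d])` is sequentially compact in the
pointwise convergence topology, for any linearly ordered set `X`. -/
theorem bv_sequentially_compact {X : Type*} [LinearOrder X] {c d r : ℝ}
    (hcd : c ≤ d) (hr : 0 < r) (f : ℕ → X → ℝ)
    (hrange : ∀ n x, f n x ∈ Set.Icc c d) (hvar : ∀ n, RealVarLE (f n) r) :
    ∃ φ : ℕ → ℕ, StrictMono φ ∧ ∃ g : X → ℝ,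
      (∀ x, g x ∈ Set.Icc c d) ∧ RealVarLE g r ∧
      ∀ x, Tendsto (fun k => f (φ k) x) atTop (𝓝 (g x)) := by
  suffices h : ∃ φ : ℕ → ℕ, StrictMono φ ∧ ∃ g : X → ℝ,
      ∀ x, Tendsto (fun k => f (φ k) x) atTop (𝓝 (g x)) by
    obtain ⟨φ, hφ, g, hg⟩ := h
    exact ⟨φ, hφ, g, fun x => isClosed_Icc.mem_of_tendsto (hg x)
      (Eventually.of_forall fun k => hrange (φ k) x),
      RealVarLE.of_tendsto_s17 (fun k => hvar (φ k)) hg, hg⟩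
  obtain hX | ⟨⟨o⟩⟩ := isEmpty_or_nonempty X
  · exact ⟨id, strictMono_id, isEmptyElim, isEmptyElim⟩
  have hbv : ∀ n, BoundedVariationOn (f n) Set.univ := fun n =>
    ((hvar n).eVariationOn_le.trans_lt ENNReal.ofReal_lt_top).ne
  let V : ℕ → X → ℝ := fun n => variationOnFromTo (f n) Set.univ o
  have hV : ∀ n x, V n x ∈ Set.Icc (-r) r := fun n x => abs_le.1 <|
    (variationOnFromTo.abs_le_eVariationOn (hbv n)).trans
      (ENNReal.toReal_le_of_le_ofReal hr.le (hvar n).eVariationOn_le)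
  have hVmono : ∀ n, Monotone (V n) := fun n => monotoneOn_univ.1 <|
    variationOnFromTo.monotoneOn (hbv n).locallyBoundedVariationOn (Set.mem_univ o)
  have hVfmono : ∀ n, Monotone (V n - f n) := fun n => monotoneOn_univ.1 <|
    variationOnFromTo.sub_self_monotoneOn (hbv n).locallyBoundedVariationOn (Set.mem_univ o)
  obtain ⟨φ, hφ, G, hG⟩ := exists_subseq_tendsto_of_monotone (by linarith) V hVmono hV
  obtain ⟨ψ, hψ, H, hH⟩ := exists_subseq_tendsto_of_monotone (a := -r - d) (b := r - c)
    (by linarith) (fun k => V (φ k) - f (φ k)) (fun k => hVfmono (φ k)) fun k x =>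
      ⟨sub_le_sub (hV (φ k) x).1 (hrange (φ k) x).2, sub_le_sub (hV (φ k) x).2 (hrange (φ k) x).1⟩
  refine ⟨φ ∘ ψ, hφ.comp hψ, G - H, fun x => ?_⟩
  simpa using ((hG x).comp hψ.tendsto_atTop).sub (hH x)
end

section
/- Let (X, ≤) be a linearly ordered set and let (Y, τ, ≤) be a compact metrizable partially ordered space, i.e., (Y, τ) is compact Hausdorff and metrizable and ≤ is a partial order on Y whose graph is closed in Y × Y. Then M_+(X,Y), the set of all order preserving maps X → Y, is a closed subset of the product space Y^X and is sequentially compact in the pointwise convergence topology: every sequence of order preserving maps f_n : X → Y has a subsequence converging pointwise to an order preserving map f : X → Y. -/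
open Filter Topology

/-- A sequence of sets forming a chain has a pointwise convergent refinement along any countably
generated filter. -/
lemma exists_filter_le_eventually_mem_or_notMem {ι X : Type*} {S : ι → Set X}
    (hS : ∀ m n, S m ⊆ S n ∨ S n ⊆ S m) (L : Filter ι) [L.NeBot] [L.IsCountablyGenerated] :
    ∃ L' ≤ L, L'.NeBot ∧ L'.IsCountablyGenerated ∧
      ∀ x, (∀ᶠ n in L', x ∈ S n) ∨ ∀ᶠ n in L', x ∉ S n := by
  obtain ⟨u, hu⟩ := exists_seq_tendsto L
  obtain ⟨g, hg⟩ := exists_increasing_or_nonincreasing_subseq (fun A B : Set X => A ⊆ B) (S ∘ u)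
  refine ⟨map (u ∘ g) atTop, hu.comp g.strictMono.tendsto_atTop, inferInstance, inferInstance,
    fun x => ?_⟩
  simp only [eventually_map, Function.comp_apply] at hg ⊢
  rcases hg with hg | hg
  · by_cases hx : ∃ m, x ∈ S (u (g m))
    · obtain ⟨m, hm⟩ := hx
      left
      filter_upwards [eventually_gt_atTop m] with n hn using hg m n hn hm
    · push Not at hx
      exact Or.inr (Eventually.of_forall hx)
  · by_cases hx : ∃ m, x ∉ S (u (g m))
    · obtain ⟨m, hm⟩ := hx
      right
      filter_upwards [eventually_gt_atTop m] with n hn hxn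
      exact hm ((hS _ _).resolve_left (hg m n hn) hxn)
    · push Not at hx
      exact Or.inl (Eventually.of_forall hx)

/-- Countably many sequences of sets, each forming a chain, have a common subsequence along which
all of them converge pointwise. -/
lemma exists_strictMono_eventually_mem_or_notMem {X : Type*} {S : ℕ → ℕ → Set X}
    (hS : ∀ k m n, S k m ⊆ S k n ∨ S k n ⊆ S k m) :
    ∃ φ : ℕ → ℕ, StrictMono φ ∧
      ∀ k x, (∀ᶠ n in atTop, x ∈ S k (φ n)) ∨ ∀ᶠ n in atTop, x ∉ S k (φ n) := by
  have step (k : ℕ) (L : {L : Filter ℕ // L.NeBot ∧ L.IsCountablyGenerated}) :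
      ∃ L' : {L : Filter ℕ // L.NeBot ∧ L.IsCountablyGenerated}, L'.1 ≤ L.1 ∧
        ∀ x, (∀ᶠ n in L'.1, x ∈ S k n) ∨ ∀ᶠ n in L'.1, x ∉ S k n := by
    obtain ⟨L, h₁, h₂⟩ := L
    obtain ⟨L', hle, h₁', h₂', h⟩ := exists_filter_le_eventually_mem_or_notMem (hS k) L
    exact ⟨⟨L', h₁', h₂'⟩, hle, h⟩
  choose F hF hFS using step
  let G : ℕ → {L : Filter ℕ // L.NeBot ∧ L.IsCountablyGenerated} :=
    fun k => Nat.rec ⟨atTop, inferInstance, inferInstance⟩ F k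
  have hG : Antitone fun k => (G k).1 := antitone_nat_of_succ_le fun k => hF k (G k)
  have hne (k : ℕ) : (G k).1.NeBot := (G k).2.1
  have (k : ℕ) : (G k).1.IsCountablyGenerated := (G k).2.2
  have : (⨅ k, (G k).1).NeBot := iInf_neBot_of_directed' hG.directed_ge hne
  obtain ⟨u, hu⟩ := exists_seq_tendsto (⨅ k, (G k).1)
  have hu' (k : ℕ) : Tendsto u atTop (G k).1 := hu.mono_right (iInf_le _ k)
  obtain ⟨ψ, hψ, hφ⟩ := strictMono_subseq_of_tendsto_atTop (hu' 0)
  refine ⟨u ∘ ψ, hφ, fun k x => ?_⟩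
  have h := (hu' (k + 1)).comp hψ.tendsto_atTop
  exact (hFS k (G k) x).imp h.eventually h.eventually

/-- If a filter on a compact space with closed partial order decides, for each basic open set,
whether a map eventually lies in the upper closure of that set, then the map converges. -/
lemma exists_tendsto_of_eventually_mem_upperClosure {ι Y : Type*} [TopologicalSpace Y]
    [CompactSpace Y] [PartialOrder Y] [OrderClosedTopology Y] {B : Set (Set Y)}
    (hB : TopologicalSpace.IsTopologicalBasis B) {l : Filter ι} [l.NeBot] {u : ι → Y}
    (h : ∀ U ∈ B, (∀ᶠ n in l, u n ∈ upperClosure U) ∨ ∀ᶠ n in l, u n ∉ upperClosure U) :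
    ∃ y, Tendsto u l (𝓝 y) := by
  have key {a b : Y} (ha : MapClusterPt a l u) (hb : MapClusterPt b l u) : a ≤ b := by
    by_contra hab
    obtain ⟨U', hU', V, hV, hUV⟩ := mem_nhds_prod_iff.1
      ((OrderClosedTopology.isClosed_le' (α := Y)).isOpen_compl.mem_nhds
        (show (a, b) ∈ {p : Y × Y | p.1 ≤ p.2}ᶜ from hab))
    obtain ⟨U, hUB, haU, hUU'⟩ := hB.mem_nhds_iff.1 hU'
    rcases h U hUB with h | h
    · obtain ⟨n, hnV, z, hzU, hz⟩ := ((hb.frequently hV).and_eventually h).exists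
      exact hUV (Set.mk_mem_prod (hUU' hzU) hnV) hz
    · obtain ⟨n, hnU, hn⟩ :=
        ((ha.frequently (hB.mem_nhds hUB haU)).and_eventually h).exists
      exact hn (subset_upperClosure hnU)
  obtain ⟨y, hy⟩ := exists_clusterPt_of_compactSpace (map u l)
  exact ⟨y, le_nhds_of_unique_clusterPt fun z hz => (key hz hy).antisymm (key hy hz)⟩

/-- Helly type theorem for order preserving maps: if `Y` is a compact metrizable
partially ordered space (in the sense of Nachbin), then `M₊(X,Y)` is closed in
`Y^X` and sequentially compact in the pointwise convergence topology. -/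
theorem monotone_maps_sequentially_compact {X : Type*} [LinearOrder X]
    {Y : Type*} [TopologicalSpace Y] [CompactSpace Y] [T2Space Y]
    [TopologicalSpace.MetrizableSpace Y] [PartialOrder Y]
    (hcl : IsClosed {p : Y × Y | p.1 ≤ p.2}) :
    IsClosed {f : X → Y | Monotone f} ∧
    ∀ f : ℕ → X → Y, (∀ n, Monotone (f n)) →
      ∃ φ : ℕ → ℕ, StrictMono φ ∧ ∃ g : X → Y, Monotone g ∧
        ∀ x, Tendsto (fun k => f (φ k) x) atTop (𝓝 (g x)) := by
  have : OrderClosedTopology Y := ⟨hcl⟩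
  refine ⟨isClosed_monotone, fun f hf => ?_⟩
  have : SecondCountableTopology Y := by
    let := TopologicalSpace.metrizableSpaceMetric Y
    infer_instance
  obtain ⟨B, hBc, -, hB⟩ := TopologicalSpace.exists_countable_basis Y
  obtain ⟨U, hU⟩ := Set.countable_iff_exists_subset_range.1 hBc
  have hup (k n : ℕ) : IsUpperSet (f n ⁻¹' (upperClosure (U k) : Set Y)) :=
    (upperClosure (U k)).upper.preimage (hf n)
  obtain ⟨φ, hφ, h⟩ := exists_strictMono_eventually_mem_or_notMem
    fun k m n => (hup k m).total (hup k n)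
  have hlim (x : X) : ∃ y, Tendsto (fun k => f (φ k) x) atTop (𝓝 y) := by
    refine exists_tendsto_of_eventually_mem_upperClosure hB fun V hV => ?_
    obtain ⟨k, rfl⟩ := hU hV
    exact h k x
  choose g hg using hlim
  exact ⟨φ, hφ, g, fun x y hxy => le_of_tendsto_of_tendsto' (hg x) (hg y)
    fun k => hf (φ k) hxy, hg⟩
end
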